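/- arXiv:1812.02284 — 11 statements merged into one kernel-verified Lean document; each statement's English description precedes it below -/
import Mathlib

section
/- Let 1 ≤ i ≤ d−1. Then: (a) the ℂ[X]-linear map ι : ℂ[X] → ℂ[X,Y]/(P_i(X,Y)) sending r(X) to the residue class of r(X)·P_{i−1}(X,Y) is injective; (b) the image of ι equals the kernel of the natural surjection ℂ[X,Y]/(P_i(X,Y)) → ℂ[X,Y]/(P_{i−1}(X,Y)); (c) X·P_{i−1}(X,Y) ≡ ζ^i Y·P_{i−1}(X,Y) modulo the ideal (P_i(X,Y)). In other words, there is a short exact sequence 0 → ℂ[X] → ℂ[X,Y]/(P_i) → ℂ[X,Y]/(P_{i−1}) → 0 where on the first term the right action of Y is twisted by ζ^{−i} times the action of X. -/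
open MvPolynomial

/-- `P_n(X,Y) = ∏_{k=0}^{n} (X - ζ^k Y)` in `ℂ[X,Y]`. -/
noncomputable def Pgen (ζ : ℂ) (n : ℕ) : MvPolynomial (Fin 2) ℂ :=
  ∏ k ∈ Finset.range (n + 1), (X 0 - C (ζ ^ k) * X 1)

theorem aux_dvd (c : ℂ) (hc : c ≠ 0) (q : MvPolynomial (Fin 2) ℂ) :
    (X 0 - C c * X 1 : MvPolynomial (Fin 2) ℂ) ∣
      Polynomial.aeval (X 0 : MvPolynomial (Fin 2) ℂ)
        (aeval (![Polynomial.X, Polynomial.C c⁻¹ * Polynomial.X] : Fin 2 → Polynomial ℂ) q) - q := by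
  rw [← Ideal.mem_span_singleton, ← Ideal.Quotient.eq]
  have h : ((Ideal.Quotient.mkₐ ℂ (Ideal.span {(X 0 - C c * X 1 : MvPolynomial (Fin 2) ℂ)})).comp
      ((Polynomial.aeval (X 0 : MvPolynomial (Fin 2) ℂ)).comp
        (aeval (![Polynomial.X, Polynomial.C c⁻¹ * Polynomial.X] : Fin 2 → Polynomial ℂ))))
      = Ideal.Quotient.mkₐ ℂ _ := by
    apply MvPolynomial.algHom_ext
    intro j
    fin_cases j
    · simp
    · simp only [AlgHom.comp_apply, Ideal.Quotient.mkₐ_eq_mk]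
      rw [Ideal.Quotient.eq, Ideal.mem_span_singleton]
      refine ⟨C c⁻¹, ?_⟩
      have h1 : (C c * C c⁻¹ : MvPolynomial (Fin 2) ℂ) = 1 := by
        rw [← C_mul, mul_inv_cancel₀ hc, C_1]
      simp [algebraMap_eq]
      linear_combination (X 1) * h1
  exact DFunLike.congr_fun h q

theorem aux_ne (ζ : ℂ) (n : ℕ) : Pgen ζ n ≠ 0 := by
  intro h
  have := congrArg (eval (![1, 0] : Fin 2 → ℂ)) h
  simp [Pgen, map_prod] at this

theorem aux_succ (ζ : ℂ) (n : ℕ) :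
    Pgen ζ (n + 1) = Pgen ζ n * (X 0 - C (ζ ^ (n + 1)) * X 1) := by
  rw [Pgen, Finset.prod_range_succ]; rfl

/-- for `1 ≤ i ≤ d-1`:
(a) the `ℂ[X]`-linear map `ι : r ↦ [r(X)·P_{i-1}(X,Y)]` into `ℂ[X,Y]/(P_i)` is injective;
(b) the image of `ι` equals the kernel of the natural surjection
`ℂ[X,Y]/(P_i) → ℂ[X,Y]/(P_{i-1})` (i.e. the image of the ideal `(P_{i-1})`);
(c) `X·P_{i-1} ≡ ζ^i·Y·P_{i-1}` modulo `(P_i)`. -/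
theorem stmt_3 (d : ℕ) (hd : 2 ≤ d) (ζ : ℂ) (hζ : IsPrimitiveRoot ζ d)
    (i : ℕ) (hi1 : 1 ≤ i) (hi : i ≤ d - 1) :
    Function.Injective (fun r : Polynomial ℂ =>
        Ideal.Quotient.mk (Ideal.span {Pgen ζ i})
          (Polynomial.aeval (X 0 : MvPolynomial (Fin 2) ℂ) r * Pgen ζ (i - 1)))
    ∧ Set.range (fun r : Polynomial ℂ =>
        Ideal.Quotient.mk (Ideal.span {Pgen ζ i})
          (Polynomial.aeval (X 0 : MvPolynomial (Fin 2) ℂ) r * Pgen ζ (i - 1)))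
      = Ideal.Quotient.mk (Ideal.span {Pgen ζ i}) ''
          ((Ideal.span {Pgen ζ (i - 1)} : Ideal (MvPolynomial (Fin 2) ℂ)) :
            Set (MvPolynomial (Fin 2) ℂ))
    ∧ X 0 * Pgen ζ (i - 1) - C (ζ ^ i) * X 1 * Pgen ζ (i - 1) ∈
        Ideal.span {Pgen ζ i} := by
  obtain ⟨n, rfl⟩ : ∃ n, i = n + 1 := ⟨i - 1, by omega⟩
  have hc : ζ ^ (n + 1) ≠ 0 := pow_ne_zero _ (hζ.ne_zero (by omega))
  simp only [Nat.add_sub_cancel]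
  refine ⟨?_, ?_, ?_⟩
  · intro r s hrs
    simp only [Ideal.Quotient.eq, Ideal.mem_span_singleton] at hrs
    rw [aux_succ, ← sub_mul, mul_comm _ (Pgen ζ n), mul_dvd_mul_iff_left (aux_ne ζ n)] at hrs
    obtain ⟨t, ht⟩ := hrs
    have h2 := congrArg
      (aeval (![Polynomial.X, Polynomial.C (ζ ^ (n + 1))⁻¹ * Polynomial.X] :
        Fin 2 → Polynomial ℂ)) ht
    have h3 : (Polynomial.C (ζ ^ (n + 1)) * Polynomial.C (ζ ^ (n + 1))⁻¹ : Polynomial ℂ) = 1 := by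
      rw [← Polynomial.C_mul, mul_inv_cancel₀ hc, Polynomial.C_1]
    have h4 : ∀ r : Polynomial ℂ, aeval (![Polynomial.X,
        Polynomial.C (ζ ^ (n + 1))⁻¹ * Polynomial.X] : Fin 2 → Polynomial ℂ)
        (Polynomial.aeval (X 0 : MvPolynomial (Fin 2) ℂ) r) = r := by
      intro r
      rw [← Polynomial.aeval_algHom_apply]
      simp
    rw [map_sub, h4, h4, map_mul, map_sub, map_mul, aeval_X, aeval_X, aeval_C] at h2
    simp only [Matrix.cons_val_zero, Matrix.cons_val_one, Polynomial.algebraMap_eq] at h2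
    rw [← mul_assoc, h3, one_mul, sub_self, zero_mul] at h2
    exact sub_eq_zero.mp h2
  · ext x
    constructor
    · rintro ⟨r, rfl⟩
      exact ⟨_, Ideal.mul_mem_left _ _ (Ideal.mem_span_singleton_self _), rfl⟩
    · rintro ⟨y, hy, rfl⟩
      obtain ⟨q, rfl⟩ := Ideal.mem_span_singleton.mp hy
      refine ⟨?_, Ideal.Quotient.eq.mpr (Ideal.mem_span_singleton.mpr ?_)⟩
      · exact aeval (![Polynomial.X, Polynomial.C (ζ ^ (n + 1))⁻¹ * Polynomial.X] :
          Fin 2 → Polynomial ℂ) q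
      · rw [aux_succ, mul_comm _ (Pgen ζ n), ← mul_sub]
        exact mul_dvd_mul_left _ (aux_dvd _ hc q)
  · rw [Ideal.mem_span_singleton, aux_succ]
    exact ⟨1, by ring⟩
end

section
/- For all integers i, j ≥ 0 with k = i + j ≤ d−1, the identity P_k(X,Y) = c_k^i · P_i(X,Z) + d_k^j · P_j(Z,Y) holds in the polynomial ring ℂ[X,Y,Z]. -/
open MvPolynomial

/-- `P_n(A,B) = ∏_{k=0}^{n} (A - ζ^k B)` for `A, B ∈ ℂ[X,Y,Z]`. -/
noncomputable def P3 (ζ : ℂ) (n : ℕ) (A B : MvPolynomial (Fin 3) ℂ) :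
    MvPolynomial (Fin 3) ℂ :=
  ∏ k ∈ Finset.range (n + 1), (A - C (ζ ^ k) * B)

/-- The polynomials `c_k^i ∈ ℂ[X,Y,Z]` (variables `X = X 0`, `Y = X 1`, `Z = X 2`):
`c_k^k = 1`; for `k ≥ 1`,
`c_k^0 = P_{k-1}(X, ζY) + Σ_{r=0}^{k-2} P_r(Z,Y)·P_{k-2-r}(X, ζ^{r+2}Y) + P_{k-1}(Z,Y)`;
and for `0 < i < k`, `c_k^i = c_{k-1}^{i-1} + c_{k-1}^{i}·ζ^{i}(Z − ζ^{k-i}Y)`. -/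
noncomputable def cc (ζ : ℂ) : ℕ → ℕ → MvPolynomial (Fin 3) ℂ
  | 0, _ => 1
  | (k + 1), 0 =>
      P3 ζ k (X 0) (C ζ * X 1)
        + ∑ r ∈ Finset.range k, P3 ζ r (X 2) (X 1) * P3 ζ (k - 1 - r) (X 0) (C (ζ ^ (r + 2)) * X 1)
        + P3 ζ k (X 2) (X 1)
  | (k + 1), (i + 1) =>
      if i + 1 = k + 1 then 1
      else cc ζ k i + cc ζ k (i + 1) * C (ζ ^ (i + 1)) * (X 2 - C (ζ ^ (k - i)) * X 1)

/-- The polynomials `d_k^j ∈ ℂ[X,Y,Z]`: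
`d_k^k = 1`; for `k ≥ 1`,
`d_k^0 = P_{k-1}(X, ζY) + Σ_{r=0}^{k-2} ζ^{r+1} P_r(X,Z)·P_{k-2-r}(X, ζ^{r+2}Y) + ζ^k P_{k-1}(X,Z)`;
and for `0 < j < k`, `d_k^j = d_{k-1}^{j}·(X − ζ^{k-j}Z) + ζ^{k-j} d_{k-1}^{j-1}`. -/
noncomputable def dd (ζ : ℂ) : ℕ → ℕ → MvPolynomial (Fin 3) ℂ
  | 0, _ => 1
  | (k + 1), 0 =>
      P3 ζ k (X 0) (C ζ * X 1)
        + ∑ r ∈ Finset.range k,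
            C (ζ ^ (r + 1)) * P3 ζ r (X 0) (X 2) * P3 ζ (k - 1 - r) (X 0) (C (ζ ^ (r + 2)) * X 1)
        + C (ζ ^ (k + 1)) * P3 ζ k (X 0) (X 2)
  | (k + 1), (j + 1) =>
      if j + 1 = k + 1 then 1
      else dd ζ k (j + 1) * (X 0 - C (ζ ^ (k - j)) * X 2) + C (ζ ^ (k - j)) * dd ζ k j

/-- Telescoping of a difference of two products. -/
theorem tele_aux {R : Type*} [CommRing R] (n : ℕ) : ∀ f g : ℕ → R,
    ∏ l ∈ Finset.range n, g l = (∏ l ∈ Finset.range n, f l) +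
      ∑ s ∈ Finset.range n, (∏ l ∈ Finset.range s, f l) * (g s - f s) *
        ∏ l ∈ Finset.range (n - 1 - s), g (s + 1 + l) := by
  induction n with
  | zero => intro f g; simp
  | succ n ih =>
    intro f g
    rw [Finset.prod_range_succ' g, Finset.prod_range_succ' f, Finset.sum_range_succ']
    have h := ih (fun l => f (l + 1)) (fun l => g (l + 1))
    have e : ∑ s ∈ Finset.range n, (∏ l ∈ Finset.range (s + 1), f l) * (g (s + 1) - f (s + 1)) *
        ∏ l ∈ Finset.range (n + 1 - 1 - (s + 1)), g (s + 1 + 1 + l)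
      = f 0 * ∑ s ∈ Finset.range n, (∏ l ∈ Finset.range s, f (l + 1)) *
          (g (s + 1) - f (s + 1)) * ∏ l ∈ Finset.range (n - 1 - s), g (s + 1 + l + 1) := by
      rw [Finset.mul_sum]
      refine Finset.sum_congr rfl fun s _ => ?_
      rw [Finset.prod_range_succ' f]
      have h1 : n + 1 - 1 - (s + 1) = n - 1 - s := by omega
      have h2 : ∀ l, s + 1 + 1 + l = s + 1 + l + 1 := fun l => by omega
      rw [h1]
      simp only [h2]
      ring
    have e2 : ∏ l ∈ Finset.range (n + 1 - 1 - 0), g (0 + 1 + l)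
        = ∏ l ∈ Finset.range n, g (l + 1) := by
      refine Finset.prod_congr rfl fun l _ => ?_
      congr 1; omega
    rw [e, e2]
    simp only [Finset.range_zero, Finset.prod_empty]
    linear_combination f 0 * h

theorem P3_shift (ζ : ℂ) (n s : ℕ) (A B : MvPolynomial (Fin 3) ℂ) :
    ∏ l ∈ Finset.range (n + 1), (A - C (ζ ^ (s + l)) * B) = P3 ζ n A (C (ζ ^ s) * B) := by
  unfold P3
  refine Finset.prod_congr rfl fun l _ => ?_
  rw [pow_add, C_mul]; ring

theorem P3_succ (ζ : ℂ) (n : ℕ) (A B : MvPolynomial (Fin 3) ℂ) :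
    P3 ζ (n + 1) A B = P3 ζ n A B * (A - C (ζ ^ (n + 1)) * B) := by
  unfold P3
  rw [Finset.prod_range_succ]

theorem P3_zero (ζ : ℂ) (A B : MvPolynomial (Fin 3) ℂ) : P3 ζ 0 A B = A - B := by
  simp [P3]

theorem cc_self (ζ : ℂ) (k : ℕ) : cc ζ k k = 1 := by
  cases k <;> simp [cc]

theorem dd_self (ζ : ℂ) (k : ℕ) : dd ζ k k = 1 := by
  cases k <;> simp [dd]

theorem cc_zero_id (ζ : ℂ) (k : ℕ) :
    P3 ζ (k + 1) (X 0) (X 1) = P3 ζ (k + 1) (X 2) (X 1) + cc ζ (k + 1) 0 * (X 0 - X 2) := by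
  have h := tele_aux (k + 1 + 1) (fun l => (X 2 - C (ζ ^ l) * X 1 : MvPolynomial (Fin 3) ℂ))
    (fun l => X 0 - C (ζ ^ l) * X 1)
  rw [Finset.sum_range_succ, Finset.sum_range_succ'] at h
  have e : ∑ s ∈ Finset.range k, (∏ l ∈ Finset.range (s + 1),
        (X 2 - C (ζ ^ l) * X 1 : MvPolynomial (Fin 3) ℂ)) *
        ((X 0 - C (ζ ^ (s + 1)) * X 1) - (X 2 - C (ζ ^ (s + 1)) * X 1)) *
        ∏ l ∈ Finset.range (k + 1 + 1 - 1 - (s + 1)), (X 0 - C (ζ ^ (s + 1 + 1 + l)) * X 1)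
      = (∑ r ∈ Finset.range k, P3 ζ r (X 2) (X 1) *
          P3 ζ (k - 1 - r) (X 0) (C (ζ ^ (r + 2)) * X 1)) * (X 0 - X 2) := by
    rw [Finset.sum_mul]
    refine Finset.sum_congr rfl fun s hs => ?_
    have hs := Finset.mem_range.1 hs
    have h1 : k + 1 + 1 - 1 - (s + 1) = k - 1 - s + 1 := by omega
    rw [h1, P3_shift]
    unfold P3
    ring
  rw [e] at h
  have e2 : k + 1 + 1 - 1 - 0 = k + 1 := by omega
  have e3 : k + 1 + 1 - 1 - (k + 1) = 0 := by omega
  rw [e2, e3, P3_shift] at h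
  simp only [Finset.range_zero, Finset.prod_empty, zero_add, pow_one] at h
  simp only [cc]
  unfold P3 at h ⊢
  linear_combination h

theorem dd_zero_id (ζ : ℂ) (k : ℕ) :
    P3 ζ (k + 1) (X 0) (X 1) = P3 ζ (k + 1) (X 0) (X 2) + dd ζ (k + 1) 0 * (X 2 - X 1) := by
  have h := tele_aux (k + 1 + 1) (fun l => (X 0 - C (ζ ^ l) * X 2 : MvPolynomial (Fin 3) ℂ))
    (fun l => X 0 - C (ζ ^ l) * X 1)
  rw [Finset.sum_range_succ, Finset.sum_range_succ'] at h
  have e : ∑ s ∈ Finset.range k, (∏ l ∈ Finset.range (s + 1),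
        (X 0 - C (ζ ^ l) * X 2 : MvPolynomial (Fin 3) ℂ)) *
        ((X 0 - C (ζ ^ (s + 1)) * X 1) - (X 0 - C (ζ ^ (s + 1)) * X 2)) *
        ∏ l ∈ Finset.range (k + 1 + 1 - 1 - (s + 1)), (X 0 - C (ζ ^ (s + 1 + 1 + l)) * X 1)
      = (∑ r ∈ Finset.range k, C (ζ ^ (r + 1)) * P3 ζ r (X 0) (X 2) *
          P3 ζ (k - 1 - r) (X 0) (C (ζ ^ (r + 2)) * X 1)) * (X 2 - X 1) := by
    rw [Finset.sum_mul]
    refine Finset.sum_congr rfl fun s hs => ?_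
    have hs := Finset.mem_range.1 hs
    have h1 : k + 1 + 1 - 1 - (s + 1) = k - 1 - s + 1 := by omega
    rw [h1, P3_shift]
    unfold P3
    ring
  rw [e] at h
  have e2 : k + 1 + 1 - 1 - 0 = k + 1 := by omega
  have e3 : k + 1 + 1 - 1 - (k + 1) = 0 := by omega
  rw [e2, e3, P3_shift] at h
  simp only [Finset.range_zero, Finset.prod_empty, zero_add, pow_one, pow_zero, C_1] at h
  simp only [dd]
  unfold P3 at h ⊢
  linear_combination h

theorem main_id (ζ : ℂ) (k : ℕ) : ∀ i j : ℕ, i + j = k →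
    P3 ζ k (X 0) (X 1)
      = cc ζ k i * P3 ζ i (X 0) (X 2) + dd ζ k j * P3 ζ j (X 2) (X 1) := by
  induction k with
  | zero =>
    intro i j h
    obtain ⟨rfl, rfl⟩ : i = 0 ∧ j = 0 := by omega
    simp only [P3_zero, cc, dd]; ring
  | succ k ih =>
    intro i j h
    rcases i with _ | i
    · obtain rfl : j = k + 1 := by omega
      rw [dd_self, P3_zero, cc_zero_id]; ring
    rcases j with _ | j
    · obtain rfl : i = k := by omega
      rw [cc_self, P3_zero, dd_zero_id]; ring
    have h1 := ih i (j + 1) (by omega)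
    have h2 := ih (i + 1) j (by omega)
    have n1 : ¬ (i + 1 = k + 1) := by omega
    have n2 : ¬ (j + 1 = k + 1) := by omega
    have e1 : k - i = j + 1 := by omega
    have e2 : k - j = i + 1 := by omega
    have e3 : C (ζ ^ (k + 1)) =
        (C (ζ ^ (i + 1)) * C (ζ ^ (j + 1)) : MvPolynomial (Fin 3) ℂ) := by
      rw [← C_mul, ← pow_add]; congr 2; omega
    simp only [cc, dd, if_neg n1, if_neg n2, e1, e2]
    rw [P3_succ ζ k, e3]
    have p1 := P3_succ ζ i (X 0) (X 2)
    have p2 := P3_succ ζ j (X 2) (X 1)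
    linear_combination (X 0 - C (ζ ^ (i + 1)) * X 2) * h1 +
      C (ζ ^ (i + 1)) * (X 2 - C (ζ ^ (j + 1)) * X 1) * h2
      - cc ζ k i * p1 - C (ζ ^ (i + 1)) * dd ζ k j * p2

/-- for all `i, j ≥ 0` with `k = i + j ≤ d−1`, the identity
`P_k(X,Y) = c_k^i·P_i(X,Z) + d_k^j·P_j(Z,Y)` holds in `ℂ[X,Y,Z]`. -/
theorem stmt_4 (d : ℕ) (hd : 2 ≤ d) (ζ : ℂ) (hζ : IsPrimitiveRoot ζ d)
    (i j : ℕ) (hij : i + j ≤ d - 1) :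
    P3 ζ (i + j) (X 0) (X 1)
      = cc ζ (i + j) i * P3 ζ i (X 0) (X 2) + dd ζ (i + j) j * P3 ζ j (X 2) (X 1) := by
  exact main_id ζ (i + j) i j rfl
end

section
/- Let 1 ≤ i < d−1 and let J ⊆ ℂ[X,Y,Z] be the ideal generated by P_1(X,Z) = (X−Z)(X−ζZ) and P_i(Z,Y) = ∏_{k=0}^{i}(Z − ζ^k Y). Then P_{i+1}(X,Y) ∈ J, so the inclusion ℂ[X,Y] ⊆ ℂ[X,Y,Z] induces a well-defined ℂ[X,Y]-module homomorphism φ : ℂ[X,Y]/(P_{i+1}(X,Y)) → ℂ[X,Y,Z]/J, and moreover φ is injective. -/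
open MvPolynomial

/-- `P_n(X,Y) = ∏_{k=0}^{n} (X - ζ^k Y)` in `ℂ[X,Y]`. -/
noncomputable def P2 (ζ : ℂ) (n : ℕ) : MvPolynomial (Fin 2) ℂ :=
  ∏ k ∈ Finset.range (n + 1), (X 0 - C (ζ ^ k) * X 1)

/-- The inclusion `ℂ[X,Y] ⊆ ℂ[X,Y,Z]`. -/
noncomputable def emb : MvPolynomial (Fin 2) ℂ →ₐ[ℂ] MvPolynomial (Fin 3) ℂ :=
  rename (Fin.castLE (by norm_num))

theorem aux_cong {R : Type*} [CommRing R] (x y z t : R) (n : ℕ) :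
    ∃ q c : R, c * (t - 1) = t ^ (n + 1) - 1 ∧
      ∏ k ∈ Finset.range (n + 1), (x - t ^ k * y) = q * ((x - z) * (x - t * z)) +
        (∏ k ∈ Finset.range n, (z - t ^ k * y)) * (z - t ^ n * y + c * (x - z)) := by
  induction n with
  | zero => exact ⟨0, 1, by ring, by simp⟩
  | succ n ih =>
    obtain ⟨q, c, hc, h⟩ := ih
    refine ⟨q * (x - t ^ (n + 1) * y) + (∏ k ∈ Finset.range n, (z - t ^ k * y)) * c,
      c + t ^ (n + 1), by linear_combination hc, ?_⟩
    rw [Finset.prod_range_succ, h, Finset.prod_range_succ _ n]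
    generalize ∏ k ∈ Finset.range n, (z - t ^ k * y) = Q
    linear_combination (Q * (x - z) * (z - t ^ n * y)) * hc

/-- Substitution `X = aY`. -/
noncomputable def ev2 (a : ℂ) : MvPolynomial (Fin 2) ℂ →ₐ[ℂ] MvPolynomial (Fin 2) ℂ :=
  aeval ![C a * X 1, X 1]

/-- Substitution `X = aY, Z = bY`. -/
noncomputable def ev3 (a b : ℂ) : MvPolynomial (Fin 3) ℂ →ₐ[ℂ] MvPolynomial (Fin 2) ℂ :=
  aeval ![C a * X 1, X 1, C b * X 1]

theorem ev3_emb (a b : ℂ) (p : MvPolynomial (Fin 2) ℂ) : ev3 a b (emb p) = ev2 a p := by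
  unfold ev3 ev2 emb
  rw [aeval_rename]
  congr 1
  congr 1
  funext j
  fin_cases j <;> rfl

theorem dvd_of_ev2 (a : ℂ) (p : MvPolynomial (Fin 2) ℂ) (h : ev2 a p = 0) :
    (X 0 - C a * X 1) ∣ p := by
  have key : ∀ p : MvPolynomial (Fin 2) ℂ, (X 0 - C a * X 1) ∣ p - ev2 a p := by
    intro p
    induction p using MvPolynomial.induction_on with
    | C r => simp [ev2]
    | add p q hp hq =>
      rw [map_add, add_sub_add_comm]
      exact dvd_add hp hq
    | mul_X p j hp =>
      have hj : (X 0 - C a * X 1) ∣ (X j : MvPolynomial (Fin 2) ℂ) - ev2 a (X j) := by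
        fin_cases j <;> simp [ev2]
      have e : p * X j - ev2 a (p * X j) =
          (p - ev2 a p) * X j + ev2 a p * (X j - ev2 a (X j)) := by
        rw [map_mul]; ring
      rw [e]
      exact dvd_add (hp.mul_right _) (hj.mul_left _)
  simpa [h] using key p

theorem prod_dvd (ζ : ℂ) (n : ℕ) (hinj : ∀ k < n, ∀ m < n, ζ ^ k = ζ ^ m → k = m)
    (p : MvPolynomial (Fin 2) ℂ) (h : ∀ k < n, ev2 (ζ ^ k) p = 0) :
    (∏ k ∈ Finset.range n, (X 0 - C (ζ ^ k) * X 1)) ∣ p := by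
  induction n with
  | zero => simp
  | succ n ih =>
    obtain ⟨q, hq⟩ := ih (fun k hk m hm => hinj k (by omega) m (by omega))
      (fun k hk => h k (by omega))
    have h1 := h n (by omega)
    rw [hq, map_mul, map_prod] at h1
    have h2 : ev2 (ζ ^ n) q = 0 := by
      refine (mul_eq_zero.1 h1).resolve_left ?_
      refine Finset.prod_ne_zero_iff.2 ?_
      intro k hk
      have hk := Finset.mem_range.1 hk
      have e : ev2 (ζ ^ n) (X 0 - C (ζ ^ k) * X 1) = C (ζ ^ n - ζ ^ k) * X 1 := by
        simp [ev2, sub_mul, algebraMap_eq]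
      rw [e]
      refine mul_ne_zero ?_ (X_ne_zero _)
      rw [Ne, C_eq_zero, sub_eq_zero]
      intro h3
      have := hinj n (by omega) k (by omega) h3
      omega
    rw [Finset.prod_range_succ, hq]
    exact mul_dvd_mul_left _ (dvd_of_ev2 _ _ h2)

theorem ev3_mem (ζ : ℂ) (i : ℕ) (a : ℂ) (b : ℕ) (hb : b ≤ i)
    (hab : a = ζ ^ b ∨ a = ζ ^ (b + 1)) (f : MvPolynomial (Fin 3) ℂ)
    (hf : f ∈ Ideal.span {P3 ζ 1 (X 0) (X 2), P3 ζ i (X 2) (X 1)}) :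
    ev3 a (ζ ^ b) f = 0 := by
  obtain ⟨u, v, rfl⟩ := Ideal.mem_span_pair.1 hf
  have h1 : ev3 a (ζ ^ b) (P3 ζ 1 (X 0) (X 2)) = 0 := by
    rcases hab with rfl | rfl
    · simp [P3, ev3, Finset.prod_range_succ]
    · simp [P3, ev3, Finset.prod_range_succ, algebraMap_eq]
      right
      ring
  have h2 : ev3 a (ζ ^ b) (P3 ζ i (X 2) (X 1)) = 0 := by
    rw [P3, map_prod]
    refine Finset.prod_eq_zero (Finset.mem_range.2 (Nat.lt_succ_of_le hb)) ?_
    simp [ev3, algebraMap_eq]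
  rw [map_add, map_mul, map_mul, h1, h2]
  simp

/-- for `1 ≤ i < d−1` and `J = (P_1(X,Z), P_i(Z,Y)) ⊆ ℂ[X,Y,Z]`, the preimage of
`J` in `ℂ[X,Y]` is exactly the ideal `(P_{i+1}(X,Y))`.  Equivalently, `P_{i+1}(X,Y) ∈ J` (so
that the induced `ℂ[X,Y]`-module map `φ : ℂ[X,Y]/(P_{i+1}(X,Y)) → ℂ[X,Y,Z]/J` is
well-defined), and `φ` is injective. -/
theorem stmt_6 (d : ℕ) (hd : 4 ≤ d) (ζ : ℂ) (hζ : IsPrimitiveRoot ζ d)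
    (i : ℕ) (hi1 : 1 ≤ i) (hi : i < d - 1) :
    ∀ p : MvPolynomial (Fin 2) ℂ,
      emb p ∈ Ideal.span {P3 ζ 1 (X 0) (X 2), P3 ζ i (X 2) (X 1)}
        ↔ p ∈ Ideal.span {P2 ζ (i + 1)} := by
  intro p
  rw [Ideal.mem_span_singleton]
  constructor
  · intro h
    refine prod_dvd ζ (i + 1 + 1) ?_ p ?_
    · intro k hk m hm e
      exact hζ.pow_inj (by omega) (by omega) e
    · intro k hk
      rcases Nat.lt_or_ge i k with h1 | h1
      · obtain rfl : k = i + 1 := by omega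
        rw [← ev3_emb _ (ζ ^ i)]
        exact ev3_mem ζ i _ i le_rfl (Or.inr rfl) _ h
      · rw [← ev3_emb _ (ζ ^ k)]
        exact ev3_mem ζ i _ k h1 (Or.inl rfl) _ h
  · rintro ⟨q, rfl⟩
    rw [map_mul]
    refine Ideal.mul_mem_right _ _ ?_
    obtain ⟨u, c, -, h⟩ := aux_cong (X 0 : MvPolynomial (Fin 3) ℂ) (X 1) (X 2) (C ζ) (i + 1)
    have e : emb (P2 ζ (i + 1)) =
        ∏ k ∈ Finset.range (i + 1 + 1), ((X 0 : MvPolynomial (Fin 3) ℂ) - C ζ ^ k * X 1) := by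
      rw [P2, map_prod]
      refine Finset.prod_congr rfl fun k _ => ?_
      simp [emb]
    rw [e, h, Ideal.mem_span_pair]
    refine ⟨u, X 2 - C ζ ^ (i + 1) * X 1 + c * (X 0 - X 2), ?_⟩
    simp only [P3, map_pow]
    rw [Finset.prod_range_succ, Finset.prod_range_one]
    ring
end

section
/- Let 1 ≤ i < d−1, let J ⊆ ℂ[X,Y,Z] be the ideal generated by P_1(X,Z) = (X−Z)(X−ζZ) and P_i(Z,Y) = ∏_{k=0}^{i}(Z − ζ^k Y), and set m = (Σ_{r=0}^{i} ζ^r)·Z − (Σ_{r=0}^{i−1} ζ^r)·X − ζ^{i}·Y ∈ ℂ[X,Y,Z]. Then: (a) m·P_{i−1}(ζ^{−1}X, Y) ∈ J, so there is a well-defined ℂ[X,Y]-module homomorphism ψ : ℂ[X,Y]/(P_{i−1}(ζ^{−1}X, Y)) → ℂ[X,Y,Z]/J sending the class of Q(X,Y) to the class of m·Q(X,Y); (b) ψ is injective, i.e., for Q ∈ ℂ[X,Y], if m·Q ∈ J then Q is divisible by P_{i−1}(ζ^{−1}X, Y). -/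
open MvPolynomial

/-- `P_{n-1}(ζ⁻¹X, Y) = ∏_{k=0}^{n-1} (ζ⁻¹X - ζ^k Y)` in `ℂ[X,Y]` (product over `k < n`). -/
noncomputable def P2t (ζ : ℂ) (n : ℕ) : MvPolynomial (Fin 2) ℂ :=
  ∏ k ∈ Finset.range n, (C ζ⁻¹ * X 0 - C (ζ ^ k) * X 1)

noncomputable def phi (c : ℂ) : MvPolynomial (Fin 3) ℂ →ₐ[ℂ] MvPolynomial (Fin 2) ℂ :=
  aeval ![X 0, X 1, C c * X 0]

lemma phi_X0 (c : ℂ) : phi c (X 0) = X 0 := by simp [phi]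
lemma phi_X1 (c : ℂ) : phi c (X 1) = X 1 := by simp [phi]
lemma phi_X2 (c : ℂ) : phi c (X 2) = C c * X 0 := by simp [phi]
lemma phi_C (c a : ℂ) : phi c (C a) = C a := by simp [phi]
lemma emb_X0 : emb (X 0) = X 0 := by simp only [emb, rename_X]; rfl
lemma emb_X1 : emb (X 1) = X 1 := by simp only [emb, rename_X]; rfl
lemma emb_C (a : ℂ) : emb (C a) = C a := by simp [emb]

lemma phi_emb (c : ℂ) (Q : MvPolynomial (Fin 2) ℂ) : phi c (emb Q) = Q := by
  have h : (phi c).comp emb = AlgHom.id ℂ _ := by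
    apply MvPolynomial.algHom_ext
    intro j
    fin_cases j
    · simp [emb_X0, phi_X0]
    · simp [emb_X1, phi_X1]
  exact DFunLike.congr_fun h Q

lemma dvd_sub_phi (c : ℂ) (F : MvPolynomial (Fin 3) ℂ) :
    (X 2 - C c * X 0) ∣ F - emb (phi c F) := by
  set I : Ideal (MvPolynomial (Fin 3) ℂ) := Ideal.span {X 2 - C c * X 0} with hI
  have h : Ideal.Quotient.mkₐ ℂ I = ((Ideal.Quotient.mkₐ ℂ I).comp emb).comp (phi c) := by
    apply MvPolynomial.algHom_ext
    intro j
    fin_cases j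
    · simp [emb_X0, phi_X0]
    · simp [emb_X1, phi_X1]
    · simp only [Fin.reduceFinMk, AlgHom.comp_apply, phi_X2, map_mul, emb_X0, emb_C]
      rw [← map_mul]
      simp only [Ideal.Quotient.mkₐ_eq_mk]
      rw [Ideal.Quotient.mk_eq_mk_iff_sub_mem]
      exact Ideal.mem_span_singleton_self _
  have h2 := DFunLike.congr_fun h F
  simp only [AlgHom.comp_apply, Ideal.Quotient.mkₐ_eq_mk] at h2
  rw [Ideal.Quotient.mk_eq_mk_iff_sub_mem] at h2
  exact Ideal.mem_span_singleton.mp h2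

lemma dvd_of_phi (c : ℂ) (F : MvPolynomial (Fin 3) ℂ) (h : phi c F = 0) :
    (X 2 - C c * X 0) ∣ F := by
  simpa [h] using dvd_sub_phi c F

lemma P2t_eq (ζ : ℂ) (h0 : ζ ≠ 0) (i : ℕ) :
    C (ζ ^ i) * P2t ζ i =
      ∏ k ∈ Finset.range i, ((X 0 : MvPolynomial (Fin 2) ℂ) - C (ζ ^ (k + 1)) * X 1) := by
  have : (C (ζ ^ i) : MvPolynomial (Fin 2) ℂ) = ∏ k ∈ Finset.range i, C ζ := by simp
  rw [this, P2t, ← Finset.prod_mul_distrib]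
  refine Finset.prod_congr rfl fun k _ => ?_
  rw [mul_sub, ← mul_assoc, ← mul_assoc, ← C_mul, ← C_mul, mul_inv_cancel₀ h0, pow_succ']
  simp

lemma phi_one_P3 (ζ : ℂ) (h0 : ζ ≠ 0) (i : ℕ) :
    phi 1 (P3 ζ i (X 2) (X 1)) = (X 0 - X 1) * (C (ζ ^ i) * P2t ζ i) := by
  rw [P2t_eq ζ h0, P3, map_prod, Finset.prod_range_succ', mul_comm]
  simp only [map_sub, map_mul, phi_X2, phi_X1, phi_C]
  simp

lemma phi_inv_P3 (ζ : ℂ) (i : ℕ) :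
    phi ζ⁻¹ (P3 ζ i (X 2) (X 1)) = P2t ζ i * (C ζ⁻¹ * X 0 - C (ζ ^ i) * X 1) := by
  rw [P3, map_prod, Finset.prod_range_succ, P2t]
  simp only [map_sub, map_mul, phi_X2, phi_X1, phi_C]

lemma phi_one_m (ζ : ℂ) (i : ℕ) :
    phi 1 (C (∑ r ∈ Finset.range (i + 1), ζ ^ r) * X 2
        - C (∑ r ∈ Finset.range i, ζ ^ r) * X 0 - C (ζ ^ i) * X 1)
      = C (ζ ^ i) * (X 0 - X 1) := by
  simp only [map_sub, map_mul, phi_X2, phi_X1, phi_X0, phi_C]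
  rw [Finset.sum_range_succ, C_add, C_1]
  ring

lemma phi_inv_m (ζ : ℂ) (h0 : ζ ≠ 0) (i : ℕ) :
    phi ζ⁻¹ (C (∑ r ∈ Finset.range (i + 1), ζ ^ r) * X 2
        - C (∑ r ∈ Finset.range i, ζ ^ r) * X 0 - C (ζ ^ i) * X 1)
      = C ζ⁻¹ * X 0 - C (ζ ^ i) * X 1 := by
  simp only [map_sub, map_mul, phi_X2, phi_X1, phi_X0, phi_C]
  have h : (∑ r ∈ Finset.range (i + 1), ζ ^ r) * ζ⁻¹ =
      (∑ r ∈ Finset.range i, ζ ^ r) + ζ⁻¹ := by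
    rw [geom_sum_succ]
    field_simp
  rw [← mul_assoc, ← C_mul, h, C_add]
  ring

/-- for `1 ≤ i < d−1`, `J = (P_1(X,Z), P_i(Z,Y)) ⊆ ℂ[X,Y,Z]` and
`m = (Σ_{r=0}^{i} ζ^r)Z − (Σ_{r=0}^{i-1} ζ^r)X − ζ^i Y`:
(a) `m·P_{i−1}(ζ⁻¹X,Y) ∈ J`, so multiplication by `m` induces a well-defined
`ℂ[X,Y]`-module map `ψ : ℂ[X,Y]/(P_{i−1}(ζ⁻¹X,Y)) → ℂ[X,Y,Z]/J`;
(b) `ψ` is injective: if `m·Q ∈ J` then `P_{i−1}(ζ⁻¹X,Y) ∣ Q`. -/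
theorem stmt_7 (d : ℕ) (hd : 4 ≤ d) (ζ : ℂ) (hζ : IsPrimitiveRoot ζ d)
    (i : ℕ) (hi1 : 1 ≤ i) (hi : i < d - 1) :
    ((C (∑ r ∈ Finset.range (i + 1), ζ ^ r) * X 2
        - C (∑ r ∈ Finset.range i, ζ ^ r) * X 0
        - C (ζ ^ i) * X 1) * emb (P2t ζ i)
      ∈ Ideal.span {P3 ζ 1 (X 0) (X 2), P3 ζ i (X 2) (X 1)})
    ∧ ∀ Q : MvPolynomial (Fin 2) ℂ,
        (C (∑ r ∈ Finset.range (i + 1), ζ ^ r) * X 2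
            - C (∑ r ∈ Finset.range i, ζ ^ r) * X 0
            - C (ζ ^ i) * X 1) * emb Q
          ∈ Ideal.span {P3 ζ 1 (X 0) (X 2), P3 ζ i (X 2) (X 1)}
        → P2t ζ i ∣ Q := by
  have h0 : ζ ≠ 0 := hζ.ne_zero (by omega)
  have h1 : ζ ≠ 1 := hζ.ne_one (by omega)
  constructor
  · set m : MvPolynomial (Fin 3) ℂ := C (∑ r ∈ Finset.range (i + 1), ζ ^ r) * X 2
        - C (∑ r ∈ Finset.range i, ζ ^ r) * X 0 - C (ζ ^ i) * X 1 with hm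
    obtain ⟨G, hG⟩ := dvd_of_phi 1 (m * emb (P2t ζ i) - P3 ζ i (X 2) (X 1)) (by
      rw [map_sub, map_mul, phi_emb, phi_one_P3 ζ h0, hm, phi_one_m]; ring)
    have h2 : phi ζ⁻¹ (m * emb (P2t ζ i) - P3 ζ i (X 2) (X 1)) = 0 := by
      rw [map_sub, map_mul, phi_emb, phi_inv_P3, hm, phi_inv_m ζ h0]; ring
    have h3 : phi ζ⁻¹ G = 0 := by
      rw [hG, map_mul] at h2
      refine (mul_eq_zero.mp h2).resolve_left ?_
      simp only [map_sub, map_mul, phi_X2, phi_X0, phi_C]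
      rw [← sub_mul, ← C_sub]
      refine mul_ne_zero ?_ (X_ne_zero _)
      rw [Ne, C_eq_zero, sub_eq_zero, inv_eq_one]
      exact h1
    obtain ⟨H, hH⟩ := dvd_of_phi ζ⁻¹ G h3
    rw [Ideal.mem_span_pair]
    refine ⟨C ζ⁻¹ * H, 1, ?_⟩
    have h4 : m * emb (P2t ζ i) =
        (X 2 - C 1 * X 0) * ((X 2 - C ζ⁻¹ * X 0) * H) + P3 ζ i (X 2) (X 1) := by
      rw [← hH, ← hG]; ring
    have h5 : (C ζ : MvPolynomial (Fin 3) ℂ) * C ζ⁻¹ = 1 := by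
      rw [← C_mul, mul_inv_cancel₀ h0, C_1]
    rw [h4]
    simp only [P3, Finset.prod_range_succ, Finset.prod_range_zero, pow_zero, pow_one, C_1]
    linear_combination (X 2 ^ 2 - X 0 * X 2) * H * h5
  · intro Q hQ
    obtain ⟨a, b, hab⟩ := Ideal.mem_span_pair.mp hQ
    have h := congrArg (phi 1) hab
    rw [map_mul (phi 1) _ (emb Q), phi_one_m, phi_emb, map_add, map_mul, map_mul,
      phi_one_P3 ζ h0] at h
    have hz : phi 1 (P3 ζ 1 (X 0) (X 2)) = 0 := by
      simp [P3, Finset.prod_range_succ, phi_X0, phi_X2]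
    rw [hz] at h
    have hx : (C (ζ ^ i) * (X 0 - X 1) : MvPolynomial (Fin 2) ℂ) ≠ 0 := by
      refine mul_ne_zero ?_ ?_
      · rw [Ne, C_eq_zero]; exact pow_ne_zero _ h0
      · rw [sub_ne_zero]
        exact fun h => absurd (X_injective h) (by decide)
    refine ⟨phi 1 b, mul_left_cancel₀ hx ?_⟩
    rw [← h]; ring
end

section
/- (Soergel's Lemma, rank-one complex case) Let 1 ≤ i < d−1 and let J ⊆ ℂ[X,Y,Z] be the ideal generated by P_1(X,Z) = (X−Z)(X−ζZ) and P_i(Z,Y) = ∏_{k=0}^{i}(Z − ζ^k Y). Then there is an isomorphism of ℂ[X,Y]-modules ℂ[X,Y,Z]/J ≅ ℂ[X,Y]/(P_{i+1}(X,Y)) ⊕ ℂ[X,Y]/(P_{i−1}(ζ^{−1}X, Y)). -/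
open MvPolynomial

lemma equiv_of_ker {G H K : Type*} [AddCommGroup G] [AddCommGroup H] [AddCommGroup K]
    (f : G →+ H) (g : G →+ K) (hf : Function.Surjective f) (hg : Function.Surjective g)
    (h : ∀ x, f x = 0 ↔ g x = 0) : ∃ e : H ≃+ K, ∀ x, e (f x) = g x := by
  have hk : f.ker = g.ker := by
    ext x; simp only [AddMonoidHom.mem_ker]; exact h x
  let e1 := QuotientAddGroup.quotientKerEquivOfSurjective f hf
  let e2 := QuotientAddGroup.quotientKerEquivOfSurjective g hg
  refine ⟨(e1.symm.trans (QuotientAddGroup.quotientAddEquivOfEq hk)).trans e2, fun x => ?_⟩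
  have : e1.symm (f x) = (QuotientAddGroup.mk x) := by
    rw [AddEquiv.symm_apply_eq]; rfl
  simp only [AddEquiv.trans_apply, this]
  rfl

/-- evaluation of `Z` at `z X`. -/
noncomputable def evz (z : ℂ) : MvPolynomial (Fin 3) ℂ →ₐ[ℂ] MvPolynomial (Fin 2) ℂ :=
  aeval ![X 0, X 1, C z * X 0]

lemma evz_X0 (z : ℂ) : evz z (X 0) = X 0 := by simp [evz]
lemma evz_X1 (z : ℂ) : evz z (X 1) = X 1 := by simp [evz]
lemma evz_X2 (z : ℂ) : evz z (X 2) = C z * X 0 := by simp [evz]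
lemma evz_C (z a : ℂ) : evz z (C a) = C a := by simp [evz, algebraMap_eq]

lemma evz_emb (z : ℂ) (p : MvPolynomial (Fin 2) ℂ) : evz z (emb p) = p := by
  have : (evz z).comp emb = AlgHom.id ℂ _ := by
    apply MvPolynomial.algHom_ext
    intro j
    fin_cases j
    · simp [emb_X0, evz_X0]
    · simp [emb_X1, evz_X1]
  exact DFunLike.congr_fun this p

/-- The second basis element. -/
noncomputable def WW (c : ℂ) : MvPolynomial (Fin 3) ℂ := C c * X 2 + C (1 - c) * X 0 - X 1

lemma WW_sq (ζ c : ℂ) (h0 : ζ ≠ 0) :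
    WW c * WW c = emb ((X 0 - X 1) + (C (1 - c + c * ζ⁻¹) * X 0 - X 1)) * WW c
      - emb ((X 0 - X 1) * (C (1 - c + c * ζ⁻¹) * X 0 - X 1))
      + C (c ^ 2 * ζ⁻¹) * P3 ζ 1 (X 0) (X 2) := by
  have hz : (C ζ⁻¹ : MvPolynomial (Fin 3) ℂ) * C ζ = 1 := by
    rw [← C_mul, inv_mul_cancel₀ h0, C_1]
  simp only [map_add, map_mul, map_sub, emb_X0, emb_X1, emb_C, WW, P3, Finset.prod_range_succ,
    Finset.prod_range_zero, pow_zero, pow_one, map_one, C_pow]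
  linear_combination (-(C c ^ 2 * X 2 * (X 2 - X 0))) * hz

lemma span_rep (ζ c : ℂ) (h0 : ζ ≠ 0) (hc : c ≠ 0) (f : MvPolynomial (Fin 3) ℂ) :
    ∃ a b u, f = emb a + emb b * WW c + u * P3 ζ 1 (X 0) (X 2) := by
  have hcc : (C c⁻¹ : MvPolynomial (Fin 3) ℂ) * C c = 1 := by
    rw [← C_mul, inv_mul_cancel₀ hc, C_1]
  induction f using MvPolynomial.induction_on with
  | C a => exact ⟨C a, 0, 0, by simp [emb_C]⟩
  | add p q hp hq =>
    obtain ⟨a, b, u, h⟩ := hp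
    obtain ⟨a', b', u', h'⟩ := hq
    refine ⟨a + a', b + b', u + u', ?_⟩
    rw [h, h']; simp only [map_add]; ring
  | mul_X p n hp =>
    obtain ⟨a, b, u, h⟩ := hp
    fin_cases n
    · refine ⟨a * X 0, b * X 0, u * X 0, ?_⟩
      simp only [map_mul, emb_X0]; rw [h]; simp; ring
    · refine ⟨a * X 1, b * X 1, u * X 1, ?_⟩
      simp only [map_mul, emb_X1]; rw [h]; simp; ring
    · have hW := WW_sq ζ c h0
      set s := (X 0 - X 1) + (C (1 - c + c * ζ⁻¹) * X 0 - X 1 : MvPolynomial (Fin 2) ℂ)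
      set q := (X 0 - X 1) * (C (1 - c + c * ζ⁻¹) * X 0 - X 1 : MvPolynomial (Fin 2) ℂ)
      have hZ : (X 2 : MvPolynomial (Fin 3) ℂ)
          = C c⁻¹ * WW c + emb (C c⁻¹ * (X 1 - C (1 - c) * X 0)) := by
        simp only [map_mul, map_sub, emb_X0, emb_X1, emb_C, WW]
        linear_combination (- X 2) * hcc
      set r := (C c⁻¹ * (X 1 - C (1 - c) * X 0) : MvPolynomial (Fin 2) ℂ)
      refine ⟨a * r - C c⁻¹ * b * q, a * C c⁻¹ + b * r + C c⁻¹ * b * s,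
        u * X 2 + C c⁻¹ * emb b * C (c ^ 2 * ζ⁻¹), ?_⟩
      change p * X 2 = _
      simp only [map_mul, map_add, map_sub, emb_C]
      rw [h]
      simp only [map_mul] at hW hZ ⊢
      linear_combination (emb a + emb b * WW c) * hZ + C c⁻¹ * emb b * hW

lemma evz_WW (z c : ℂ) : evz z (WW c) = C (1 - c + c * z) * X 0 - X 1 := by
  simp only [WW, map_add, map_sub, map_mul, evz_X0, evz_X1, evz_X2, evz_C]
  ring

lemma evz_P3 (z ζ : ℂ) (hz : z = 1 ∨ z * ζ = 1) : evz z (P3 ζ 1 (X 0) (X 2)) = 0 := by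
  simp only [P3, Finset.prod_range_succ,
    Finset.prod_range_zero, pow_zero, pow_one, map_mul, map_sub, evz_X0, evz_X2, evz_C, map_one,
    one_mul]
  rcases hz with rfl | hz
  · simp
  · have : (C z : MvPolynomial (Fin 2) ℂ) * C ζ = 1 := by rw [← C_mul, hz, C_1]
    linear_combination (-(X 0 - C z * X 0) * X 0) * this

lemma rep_unique (ζ c : ℂ) (h0 : ζ ≠ 0) (h1 : ζ ≠ 1) (hc : c ≠ 0) (a b a' b' : MvPolynomial (Fin 2) ℂ)
    (h : evz 1 (emb a + emb b * WW c) = evz 1 (emb a' + emb b' * WW c))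
    (h' : evz ζ⁻¹ (emb a + emb b * WW c) = evz ζ⁻¹ (emb a' + emb b' * WW c)) :
    a = a' ∧ b = b' := by
  simp only [map_add, map_mul, evz_emb, evz_WW] at h h'
  have h1' : 1 - ζ⁻¹ ≠ 0 := by
    intro hh; apply h1; rw [sub_eq_zero] at hh; exact (inv_eq_one.mp hh.symm)
  have key : (C (c * (1 - ζ⁻¹)) * X 0) * (b - b') = (0 : MvPolynomial (Fin 2) ℂ) := by
    simp only [C_mul, C_sub, C_add, map_one] at h h' ⊢
    linear_combination h - h'
  have hb : b = b' := by
    rcases mul_eq_zero.mp key with hk | hk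
    · exfalso
      rcases mul_eq_zero.mp hk with hk | hk
      · rw [C_eq_zero] at hk
        exact mul_ne_zero hc h1' hk
      · exact X_ne_zero _ hk
    · exact sub_eq_zero.mp hk
  subst hb
  exact ⟨by linear_combination h, rfl⟩

/-- `∏_{k=1}^{i} (X - ζ^k Y)` -/
noncomputable def QQ (ζ : ℂ) (i : ℕ) : MvPolynomial (Fin 2) ℂ :=
  ∏ k ∈ Finset.range i, (X 0 - C (ζ ^ (k + 1)) * X 1)

lemma P2_eq (ζ : ℂ) (i : ℕ) : P2 ζ i = (X 0 - X 1) * QQ ζ i := by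
  rw [P2, QQ, Finset.prod_range_succ']; simp [mul_comm]

lemma QQ_succ (ζ : ℂ) (i : ℕ) : QQ ζ (i + 1) = QQ ζ i * (X 0 - C (ζ ^ (i + 1)) * X 1) := by
  rw [QQ, QQ, Finset.prod_range_succ]

lemma P2t_eq_s8 (ζ : ℂ) (h0 : ζ ≠ 0) (i : ℕ) : P2t ζ i = C (ζ⁻¹ ^ i) * QQ ζ i := by
  have hz : (C ζ⁻¹ : MvPolynomial (Fin 2) ℂ) * C ζ = 1 := by
    rw [← C_mul, inv_mul_cancel₀ h0, C_1]
  rw [P2t, QQ, C_pow]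
  have hp : (C ζ⁻¹ : MvPolynomial (Fin 2) ℂ) ^ i = ∏ _k ∈ Finset.range i, C ζ⁻¹ := by
    rw [Finset.prod_const, Finset.card_range]
  rw [hp, ← Finset.prod_mul_distrib]
  refine Finset.prod_congr rfl fun k _ => ?_
  rw [pow_succ, C_mul]
  linear_combination (C (ζ ^ k) * X 1) * hz

lemma evz_one_g (ζ : ℂ) (i : ℕ) : evz 1 (P3 ζ i (X 2) (X 1)) = (X 0 - X 1) * QQ ζ i := by
  rw [← P2_eq, P3, P2, map_prod]
  simp only [map_sub, map_mul, evz_X1, evz_X2, evz_C, map_one, one_mul]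

lemma evz_inv_g (ζ : ℂ) (h0 : ζ ≠ 0) (i : ℕ) :
    evz ζ⁻¹ (P3 ζ i (X 2) (X 1)) = C (ζ⁻¹ ^ (i + 1)) * QQ ζ (i + 1) := by
  rw [← P2t_eq_s8 ζ h0, P3, P2t, map_prod]
  simp only [map_sub, map_mul, evz_X1, evz_X2, evz_C]

theorem core (ζ : ℂ) (i : ℕ) (h0 : ζ ≠ 0) (h1 : ζ ≠ 1) (c : ℂ) (hc : c ≠ 0)
    (hce : c * (1 - ζ⁻¹) = 1 - ζ⁻¹ ^ (i + 1)) (a b : MvPolynomial (Fin 2) ℂ) :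
    emb a + emb b * WW c ∈ Ideal.span {P3 ζ 1 (X 0) (X 2), P3 ζ i (X 2) (X 1)} ↔
      a ∈ Ideal.span {P2 ζ (i + 1)} ∧ b ∈ Ideal.span {P2t ζ i} := by
  have hk : 1 - c + c * ζ⁻¹ = ζ⁻¹ ^ (i + 1) := by linear_combination - hce
  have e1 := evz_P3 1 ζ (Or.inl rfl)
  have e2 := evz_P3 ζ⁻¹ ζ (Or.inr (inv_mul_cancel₀ h0))
  have hzz : (C (ζ⁻¹ ^ (i + 1)) : MvPolynomial (Fin 2) ℂ) * C (ζ ^ (i + 1)) = 1 := by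
    rw [← C_mul, ← mul_pow, inv_mul_cancel₀ h0, one_pow, C_1]
  have hzi : (C (ζ⁻¹ ^ i) : MvPolynomial (Fin 2) ℂ) * C (ζ ^ i) = 1 := by
    rw [← C_mul, ← mul_pow, inv_mul_cancel₀ h0, one_pow, C_1]
  have g1 := evz_one_g ζ i
  have g2 := evz_inv_g ζ h0 i
  have hW := WW_sq ζ c h0
  rw [hk] at hW
  -- `g = Q W + u * quad`
  obtain ⟨u, hg⟩ : ∃ u, P3 ζ i (X 2) (X 1)
      = emb (QQ ζ i) * WW c + u * P3 ζ 1 (X 0) (X 2) := by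
    obtain ⟨a', b', u, h⟩ := span_rep ζ c h0 hc (P3 ζ i (X 2) (X 1))
    have := rep_unique ζ c h0 h1 hc a' b' 0 (QQ ζ i)
      (by
        have h' := congrArg (evz 1) h
        rw [g1, map_add, map_mul _ u, e1] at h'
        rw [mul_zero, add_zero] at h'
        rw [← h']
        simp only [map_zero, zero_add, map_mul, evz_emb, evz_WW]
        simp [mul_comm])
      (by
        have h' := congrArg (evz ζ⁻¹) h
        rw [g2, map_add, map_mul _ u, e2] at h'
        rw [mul_zero, add_zero] at h'
        rw [← h']
        simp only [map_zero, zero_add, map_mul, evz_emb, evz_WW, hk, QQ_succ]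
        linear_combination (-QQ ζ i * X 1) * hzz)
    obtain ⟨rfl, rfl⟩ := this
    exact ⟨u, by rw [h]; simp⟩
  have hP2 : (X 0 - X 1) * (C (ζ⁻¹ ^ (i + 1)) * X 0 - X 1) * QQ ζ i
      = C (ζ⁻¹ ^ (i + 1)) * P2 ζ (i + 1) := by
    rw [P2_eq, QQ_succ]
    linear_combination (X 0 - X 1) * QQ ζ i * X 1 * hzz
  have hP2' : P2 ζ (i + 1) = C (ζ ^ (i + 1)) *
      ((X 0 - X 1) * (C (ζ⁻¹ ^ (i + 1)) * X 0 - X 1) * QQ ζ i) := by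
    rw [hP2]; linear_combination (- P2 ζ (i + 1)) * hzz
  have hQ : QQ ζ i = C (ζ ^ i) * P2t ζ i := by
    rw [P2t_eq_s8 ζ h0]; linear_combination (- QQ ζ i) * hzi
  set q := (X 0 - X 1) * (C (ζ⁻¹ ^ (i + 1)) * X 0 - X 1 : MvPolynomial (Fin 2) ℂ)
  set s := (X 0 - X 1) + (C (ζ⁻¹ ^ (i + 1)) * X 0 - X 1 : MvPolynomial (Fin 2) ℂ)
  rw [Ideal.mem_span_pair, Ideal.mem_span_singleton', Ideal.mem_span_singleton']
  constructor
  · rintro ⟨v', v, h⟩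
    obtain ⟨α, β, t, hv⟩ := span_rep ζ c h0 hc v
    have : ∃ r, emb a + emb b * WW c = emb (-(β * (q * QQ ζ i))) + emb ((α + β * s) * QQ ζ i) * WW c
        + r * P3 ζ 1 (X 0) (X 2) := by
      refine ⟨v' + v * u + t * emb (QQ ζ i) * WW c + emb β * emb (QQ ζ i) * C (c ^ 2 * ζ⁻¹), ?_⟩
      rw [← h, hg]
      simp only [map_neg, map_mul emb, map_add emb] at hW ⊢
      linear_combination (emb (QQ ζ i) * WW c) * hv + emb β * emb (QQ ζ i) * hW
    obtain ⟨r, hr⟩ := this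
    obtain ⟨ha, hb⟩ := rep_unique ζ c h0 h1 hc a b (-(β * (q * QQ ζ i))) ((α + β * s) * QQ ζ i)
      (by rw [hr, map_add _ _ (r * _), map_mul _ r, e1, mul_zero, add_zero])
      (by rw [hr, map_add _ _ (r * _), map_mul _ r, e2, mul_zero, add_zero])
    refine ⟨⟨-(β * C (ζ⁻¹ ^ (i + 1))), ?_⟩, ⟨(α + β * s) * C (ζ ^ i), ?_⟩⟩
    · rw [ha, hP2]; ring
    · rw [hb, hQ]; ring
  · rintro ⟨⟨x, rfl⟩, ⟨y, rfl⟩⟩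
    rw [hP2', P2t_eq_s8 ζ h0]
    set x' := x * C (ζ ^ (i + 1))
    -- emb (q Q) = Q (s W - W² + k quad)
    refine ⟨emb x' * emb (QQ ζ i) * C (c ^ 2 * ζ⁻¹) - emb x' * (emb s - WW c) * u
      - emb (y * C (ζ⁻¹ ^ i)) * u, emb x' * (emb s - WW c) + emb (y * C (ζ⁻¹ ^ i)), ?_⟩
    have hx : x * (C (ζ ^ (i + 1)) * (q * QQ ζ i)) = x' * q * QQ ζ i := by
      simp only [x']; ring
    rw [hx, hg]
    simp only [map_mul emb] at hW ⊢
    linear_combination (-(emb x' * emb (QQ ζ i))) * hW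

/-- Soergel's Lemma, rank-one complex case: for `1 ≤ i < d−1` and
`J = (P_1(X,Z), P_i(Z,Y)) ⊆ ℂ[X,Y,Z]`, there is an isomorphism of `ℂ[X,Y]`-modules
`ℂ[X,Y,Z]/J ≅ ℂ[X,Y]/(P_{i+1}(X,Y)) ⊕ ℂ[X,Y]/(P_{i−1}(ζ⁻¹X,Y))`, stated as an additive
isomorphism commuting with the action of every `p ∈ ℂ[X,Y]`. -/
theorem stmt_8 (d : ℕ) (hd : 4 ≤ d) (ζ : ℂ) (hζ : IsPrimitiveRoot ζ d)
    (i : ℕ) (hi1 : 1 ≤ i) (hi : i < d - 1) :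
    ∃ e : (MvPolynomial (Fin 3) ℂ ⧸
            Ideal.span {P3 ζ 1 (X 0) (X 2), P3 ζ i (X 2) (X 1)}) ≃+
          ((MvPolynomial (Fin 2) ℂ ⧸ Ideal.span {P2 ζ (i + 1)}) ×
            (MvPolynomial (Fin 2) ℂ ⧸ Ideal.span {P2t ζ i})),
      ∀ (p : MvPolynomial (Fin 2) ℂ)
        (x : MvPolynomial (Fin 3) ℂ ⧸
          Ideal.span {P3 ζ 1 (X 0) (X 2), P3 ζ i (X 2) (X 1)}),
        e (Ideal.Quotient.mk _ (emb p) * x)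
          = (Ideal.Quotient.mk _ p * (e x).1, Ideal.Quotient.mk _ p * (e x).2) := by
  have h0 : ζ ≠ 0 := hζ.ne_zero (by omega)
  have h1 : ζ ≠ 1 := hζ.ne_one (by omega)
  have h1' : 1 - ζ⁻¹ ≠ 0 := by
    intro hh; apply h1; rw [sub_eq_zero] at hh; exact (inv_eq_one.mp hh.symm)
  have h2 : 1 - ζ⁻¹ ^ (i + 1) ≠ 0 := by
    intro hh
    rw [sub_eq_zero, inv_pow] at hh
    exact hζ.pow_ne_one_of_pos_of_lt (by omega) (by omega) (inv_eq_one.mp hh.symm)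
  obtain ⟨c, hc, hce⟩ : ∃ c : ℂ, c ≠ 0 ∧ c * (1 - ζ⁻¹) = 1 - ζ⁻¹ ^ (i + 1) :=
    ⟨(1 - ζ⁻¹ ^ (i + 1)) / (1 - ζ⁻¹), div_ne_zero h2 h1', div_mul_cancel₀ _ h1'⟩
  have hcore := core ζ i h0 h1 c hc hce
  set J := Ideal.span {P3 ζ 1 (X 0) (X 2), P3 ζ i (X 2) (X 1)} with hJ
  let f : MvPolynomial (Fin 2) ℂ × MvPolynomial (Fin 2) ℂ →+ (MvPolynomial (Fin 3) ℂ ⧸ J) :=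
    { toFun := fun x => Ideal.Quotient.mk J (emb x.1 + emb x.2 * WW c)
      map_zero' := by simp
      map_add' := by
        intro x y
        rw [← map_add]
        congr 1
        simp only [Prod.fst_add, Prod.snd_add, map_add]
        ring }
  let g : MvPolynomial (Fin 2) ℂ × MvPolynomial (Fin 2) ℂ →+
      ((MvPolynomial (Fin 2) ℂ ⧸ Ideal.span {P2 ζ (i + 1)}) ×
            (MvPolynomial (Fin 2) ℂ ⧸ Ideal.span {P2t ζ i})) :=
    { toFun := fun x => (Ideal.Quotient.mk _ x.1, Ideal.Quotient.mk _ x.2)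
      map_zero' := by simp
      map_add' := by intro x y; simp }
  have hf : Function.Surjective f := by
    intro y
    obtain ⟨y, rfl⟩ := Ideal.Quotient.mk_surjective y
    obtain ⟨a, b, u, h⟩ := span_rep ζ c h0 hc y
    refine ⟨(a, b), ?_⟩
    change Ideal.Quotient.mk J (emb a + emb b * WW c) = _
    rw [h, Ideal.Quotient.eq, sub_add_cancel_left]
    exact J.neg_mem (J.mul_mem_left _ (Ideal.subset_span (by simp)))
  have hg : Function.Surjective g := by
    rintro ⟨y, z⟩
    obtain ⟨y, rfl⟩ := Ideal.Quotient.mk_surjective y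
    obtain ⟨z, rfl⟩ := Ideal.Quotient.mk_surjective z
    exact ⟨(y, z), rfl⟩
  obtain ⟨e, he⟩ := equiv_of_ker f g hf hg (by
    rintro ⟨a, b⟩
    change Ideal.Quotient.mk J (emb a + emb b * WW c) = 0 ↔
      ((Ideal.Quotient.mk _ a, Ideal.Quotient.mk _ b) : _ × _) = 0
    rw [Ideal.Quotient.eq_zero_iff_mem, hcore, Prod.mk_eq_zero, Ideal.Quotient.eq_zero_iff_mem,
      Ideal.Quotient.eq_zero_iff_mem])
  refine ⟨e, fun p x => ?_⟩
  obtain ⟨⟨a, b⟩, rfl⟩ := hf x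
  have : Ideal.Quotient.mk J (emb p) * f (a, b) = f (p * a, p * b) := by
    change Ideal.Quotient.mk J (emb p) * Ideal.Quotient.mk J (emb a + emb b * WW c) =
      Ideal.Quotient.mk J (emb (p * a) + emb (p * b) * WW c)
    rw [← map_mul]
    congr 1
    simp only [map_mul]
    ring
  rw [this, he, he]
  rfl
end

section
/- Let A ⊆ ℂ[X] be the ℂ-subalgebra generated by X^d (the invariants of the order-d automorphism X ↦ ζ^{−1}X). Then the ℂ-algebra homomorphism ℂ[X] ⊗_A ℂ[X] → ℂ[X,Y]/(X^d − Y^d) sending p ⊗ q to the residue class of p(X)·q(Y) is an isomorphism. -/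
open MvPolynomial TensorProduct

theorem tensor_lift_aux {P B : Type} [CommRing P] [Algebra ℂ P] [CommRing B] (A : Subalgebra ℂ P)
    (f g : P →+* B) (h : ∀ a ∈ A, f a = g a) :
    ∃ F : P ⊗[↥A] P →+* B, ∀ p q, F (p ⊗ₜ q) = f p * g q := by
  let _ : Algebra A B := (f.comp A.val.toRingHom).toAlgebra
  let f' : P →ₐ[A] B := { f with commutes' := fun a => rfl }
  let g' : P →ₐ[A] B := { g with commutes' := fun a => (h a.1 a.2).symm }
  refine ⟨(Algebra.TensorProduct.lift f' g' (fun _ _ => Commute.all _ _)).toRingHom, ?_⟩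
  intro p q
  exact Algebra.TensorProduct.lift_tmul _ _ _ p q

theorem quot_lift_aux {T : Type} [CommRing T] (d : ℕ) (l r : Polynomial ℂ →+* T)
    (hX : l (Polynomial.X ^ d) = r (Polynomial.X ^ d))
    (hC : ∀ z, l (Polynomial.C z) = r (Polynomial.C z)) :
    ∃ G : (MvPolynomial (Fin 2) ℂ ⧸
        Ideal.span {(X 0 : MvPolynomial (Fin 2) ℂ) ^ d - X 1 ^ d}) →+* T,
      ∀ p q : Polynomial ℂ, G (Ideal.Quotient.mk _
        (Polynomial.aeval (X 0 : MvPolynomial (Fin 2) ℂ) p *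
          Polynomial.aeval (X 1 : MvPolynomial (Fin 2) ℂ) q)) = l p * r q := by
  let G0 : MvPolynomial (Fin 2) ℂ →+* T :=
    eval₂Hom (l.comp Polynomial.C) ![l Polynomial.X, r Polynomial.X]
  have hG0X : G0 (X 0) = l Polynomial.X := by simp [G0]
  have hG0Y : G0 (X 1) = r Polynomial.X := by simp [G0]
  have hG0C : ∀ z, G0 (C z) = l (Polynomial.C z) := by intro z; simp [G0]
  have hle : Ideal.span {(X 0 : MvPolynomial (Fin 2) ℂ) ^ d - X 1 ^ d} ≤ RingHom.ker G0 := by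
    rw [Ideal.span_le, Set.singleton_subset_iff]
    change G0 _ = 0
    rw [map_sub, map_pow, map_pow, hG0X, hG0Y, ← map_pow, ← map_pow, hX, sub_self]
  refine ⟨Ideal.Quotient.lift _ G0 (fun a ha => RingHom.mem_ker.mp (hle ha)), fun p q => ?_⟩
  refine (Ideal.Quotient.lift_mk _ _ _).trans ?_
  rw [map_mul]
  have h0 : G0.comp (Polynomial.aeval (X 0 : MvPolynomial (Fin 2) ℂ)).toRingHom = l := by
    apply Polynomial.ringHom_ext
    · intro z
      simpa [MvPolynomial.algebraMap_eq] using hG0C z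
    · simpa using hG0X
  have h1 : G0.comp (Polynomial.aeval (X 1 : MvPolynomial (Fin 2) ℂ)).toRingHom = r := by
    apply Polynomial.ringHom_ext
    · intro z
      simpa [MvPolynomial.algebraMap_eq] using (hG0C z).trans (hC z)
    · simpa using hG0Y
  congr 1
  · exact RingHom.congr_fun h0 p
  · exact RingHom.congr_fun h1 q

/-- with `A = ℂ[X^d] ⊆ ℂ[X]` the subalgebra generated by `X^d`, the
`ℂ`-algebra homomorphism `ℂ[X] ⊗_A ℂ[X] → ℂ[X,Y]/(X^d − Y^d)`, `p ⊗ q ↦ [p(X)·q(Y)]`,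
is an isomorphism (stated as: there is a ring isomorphism acting as prescribed on
pure tensors). -/
theorem stmt_9 (d : ℕ) (hd : 2 ≤ d) (ζ : ℂ) (hζ : IsPrimitiveRoot ζ d) :
    ∃ e : (Polynomial ℂ) ⊗[↥(Algebra.adjoin ℂ {(Polynomial.X : Polynomial ℂ) ^ d})]
          (Polynomial ℂ) ≃+*
        (MvPolynomial (Fin 2) ℂ ⧸
          Ideal.span {(X 0 : MvPolynomial (Fin 2) ℂ) ^ d - X 1 ^ d}),
      ∀ p q : Polynomial ℂ,
        e (p ⊗ₜ q)
          = Ideal.Quotient.mk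
              (Ideal.span {(X 0 : MvPolynomial (Fin 2) ℂ) ^ d - X 1 ^ d})
              (Polynomial.aeval (X 0 : MvPolynomial (Fin 2) ℂ) p *
                Polynomial.aeval (X 1 : MvPolynomial (Fin 2) ℂ) q) := by
  set A := Algebra.adjoin ℂ {(Polynomial.X : Polynomial ℂ) ^ d} with hA
  set I := Ideal.span {(X 0 : MvPolynomial (Fin 2) ℂ) ^ d - X 1 ^ d} with hI
  let f : Polynomial ℂ →ₐ[ℂ] (MvPolynomial (Fin 2) ℂ ⧸ I) :=
    (Ideal.Quotient.mkₐ ℂ I).comp (Polynomial.aeval (X 0 : MvPolynomial (Fin 2) ℂ))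
  let g : Polynomial ℂ →ₐ[ℂ] (MvPolynomial (Fin 2) ℂ ⧸ I) :=
    (Ideal.Quotient.mkₐ ℂ I).comp (Polynomial.aeval (X 1 : MvPolynomial (Fin 2) ℂ))
  have hfg : ∀ a ∈ A, f a = g a := by
    have hle : A ≤ AlgHom.equalizer f g := by
      rw [hA, Algebra.adjoin_le_iff, Set.singleton_subset_iff]
      change f (Polynomial.X ^ d) = g (Polynomial.X ^ d)
      simp only [f, g, AlgHom.comp_apply, map_pow, Polynomial.aeval_X, Ideal.Quotient.mkₐ_eq_mk]
      rw [← map_pow, ← map_pow, Ideal.Quotient.eq]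
      exact Ideal.subset_span rfl
    exact fun a ha => hle ha
  obtain ⟨F, hF⟩ := tensor_lift_aux A f.toRingHom g.toRingHom hfg
  have mv : ∀ a ∈ A, (a ⊗ₜ 1 : Polynomial ℂ ⊗[↥A] Polynomial ℂ) = 1 ⊗ₜ a := by
    intro a ha
    have := TensorProduct.smul_tmul (R := A) (⟨a, ha⟩ : A) (1 : Polynomial ℂ) (1 : Polynomial ℂ)
    simpa [Subalgebra.smul_def] using this
  obtain ⟨G, hG⟩ := quot_lift_aux (T := Polynomial ℂ ⊗[↥A] Polynomial ℂ) d
    Algebra.TensorProduct.includeLeftRingHom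
    (Algebra.TensorProduct.includeRight :
      Polynomial ℂ →ₐ[A] Polynomial ℂ ⊗[↥A] Polynomial ℂ).toRingHom
    (mv _ (Algebra.subset_adjoin rfl)) (fun z => mv _ (A.algebraMap_mem z))
  have hF' : ∀ p q, F (p ⊗ₜ q) = Ideal.Quotient.mk I
      (Polynomial.aeval (X 0 : MvPolynomial (Fin 2) ℂ) p *
        Polynomial.aeval (X 1 : MvPolynomial (Fin 2) ℂ) q) := by
    intro p q
    rw [hF, map_mul]; rfl
  have hG' : ∀ p q : Polynomial ℂ, G (Ideal.Quotient.mk I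
      (Polynomial.aeval (X 0 : MvPolynomial (Fin 2) ℂ) p *
        Polynomial.aeval (X 1 : MvPolynomial (Fin 2) ℂ) q)) = p ⊗ₜ q := by
    intro p q
    refine (hG p q).trans ?_
    change (p ⊗ₜ 1 : Polynomial ℂ ⊗[↥A] Polynomial ℂ) * (1 ⊗ₜ q) = p ⊗ₜ q
    rw [Algebra.TensorProduct.tmul_mul_tmul, one_mul, mul_one]
  have hFG : ∀ p q : Polynomial ℂ, F (G (Ideal.Quotient.mk I
      (Polynomial.aeval (X 0 : MvPolynomial (Fin 2) ℂ) p *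
        Polynomial.aeval (X 1 : MvPolynomial (Fin 2) ℂ) q))) = Ideal.Quotient.mk I
      (Polynomial.aeval (X 0 : MvPolynomial (Fin 2) ℂ) p *
        Polynomial.aeval (X 1 : MvPolynomial (Fin 2) ℂ) q) := by
    intro p q
    rw [hG', hF']
  refine ⟨RingEquiv.ofRingHom F G ?_ ?_, hF'⟩
  · apply Ideal.Quotient.ringHom_ext
    apply MvPolynomial.ringHom_ext
    · intro z
      simpa [MvPolynomial.algebraMap_eq] using hFG (Polynomial.C z) 1
    · intro i
      fin_cases i
      · simpa using hFG Polynomial.X 1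
      · simpa using hFG 1 Polynomial.X
  · apply RingHom.ext
    intro x
    change G (F x) = x
    induction x using TensorProduct.induction_on with
    | zero => exact (congrArg G (map_zero F)).trans (map_zero G)
    | add x y hx hy =>
      exact ((congrArg G (map_add F x y)).trans (map_add G _ _)).trans (congrArg₂ _ hx hy)
    | tmul p q => rw [hF', hG']
end

section
/- The images in A of the monomials S^i T_j for 0 ≤ i ≤ d−1 and 0 ≤ j ≤ d−2, together with the image of T_{d−1}, form a basis of A as a ℂ-vector space; in particular dim_ℂ A = d(d−1) + 1. -/
open MvPolynomial

/-- The generator `S` of the polynomial ring `ℂ[S, T_1, …, T_{d-1}]`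
(realized as `MvPolynomial (Fin d) ℂ`, with `S` the variable of index `0`). -/
noncomputable def Sg (d : ℕ) : MvPolynomial (Fin d) ℂ :=
  if h : 0 < d then X ⟨0, h⟩ else 1

/-- The generator `T_j` (variable of index `j` for `1 ≤ j ≤ d−1`), with the
convention `T_0 = 1`. -/
noncomputable def Tg (d : ℕ) (j : ℕ) : MvPolynomial (Fin d) ℂ :=
  if h : 1 ≤ j ∧ j ≤ d - 1 then X ⟨j, by omega⟩ else 1

/-- The defining ideal of the algebra `A_W^ℂ`: it is generated by `S^d − 1`,
`T_1·T_i − T_{i+1} − S·T_{i−1}` for `1 ≤ i ≤ d−2`, `T_1·T_{d−1} − (v+v⁻¹)·T_{d−1}`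
and `S·T_{d−1} − T_{d−1}` (with the convention `T_0 = 1`). -/
noncomputable def AIdeal (d : ℕ) (v : ℂ) : Ideal (MvPolynomial (Fin d) ℂ) :=
  Ideal.span
    ({Sg d ^ d - 1}
      ∪ (fun i : ℕ => Tg d 1 * Tg d i - Tg d (i + 1) - Sg d * Tg d (i - 1)) ''
          {i : ℕ | 1 ≤ i ∧ i ≤ d - 2}
      ∪ {Tg d 1 * Tg d (d - 1) - C (v + v⁻¹) * Tg d (d - 1),
          Sg d * Tg d (d - 1) - Tg d (d - 1)})


section spanning

variable {A : Type*} [CommRing A] [Algebra ℂ A]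

theorem aux_span_mem (d : ℕ) (hd : 3 ≤ d) (c : ℂ) (s : A) (t : ℕ → A)
    (h0 : t 0 = 1) (hs : s ^ d = 1)
    (hr : ∀ i, 1 ≤ i → i ≤ d - 2 → t 1 * t i = t (i + 1) + s * t (i - 1))
    (hT : t 1 * t (d - 1) = c • t (d - 1)) (hS : s * t (d - 1) = t (d - 1))
    (M : Submodule ℂ A)
    (hM : M = Submodule.span ℂ (Set.range (Sum.elim
      (fun ij : Fin d × Fin (d - 1) => s ^ (ij.1 : ℕ) * t (ij.2 : ℕ))
      (fun _ : Unit => t (d - 1))))) :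
    (1 : A) ∈ M ∧ (∀ x ∈ M, s * x ∈ M) ∧ (∀ j, j ≤ d - 1 → ∀ x ∈ M, t j * x ∈ M) := by
  have hStop : ∀ i : ℕ, s ^ i * t (d - 1) = t (d - 1) := by
    intro i
    induction i with
    | zero => simp
    | succ k ih => rw [pow_succ, mul_assoc, hS, ih]
  have hmem : ∀ i j : ℕ, j ≤ d - 1 → s ^ i * t j ∈ M := by
    intro i j hj
    rcases Nat.lt_or_ge j (d - 1) with hj' | hj'
    · have h1 : s ^ i = s ^ (i % d) := by
        conv_lhs => rw [← Nat.mod_add_div i d, pow_add, pow_mul, hs, one_pow, mul_one]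
      rw [h1, hM]
      exact Submodule.subset_span
        ⟨Sum.inl (⟨i % d, Nat.mod_lt _ (by omega)⟩, ⟨j, hj'⟩), rfl⟩
    · have : j = d - 1 := le_antisymm hj hj'
      subst this
      rw [hStop, hM]
      exact Submodule.subset_span ⟨Sum.inr (), rfl⟩
  have hclos : ∀ a : A, (∀ i j : ℕ, j ≤ d - 1 → a * (s ^ i * t j) ∈ M) →
      ∀ x ∈ M, a * x ∈ M := by
    intro a ha x hx
    rw [hM] at hx
    induction hx using Submodule.span_induction with
    | mem x h =>
      obtain ⟨y, rfl⟩ := h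
      rcases y with ⟨i, j⟩ | _
      · exact ha i j (by omega)
      · have := ha 0 (d - 1) le_rfl
        simpa using this
    | zero => simp
    | add x y hx hy h1 h2 =>
      rw [mul_add]
      exact M.add_mem h1 h2
    | smul r x hx h1 =>
      rw [mul_smul_comm]
      exact M.smul_mem _ h1
  have hSc : ∀ x ∈ M, s * x ∈ M := by
    apply hclos
    intro i j hj
    have := hmem (i + 1) j hj
    rwa [pow_succ', mul_assoc] at this
  have hTc : ∀ x ∈ M, t 1 * x ∈ M := by
    apply hclos
    intro i j hj
    rcases Nat.eq_zero_or_pos j with rfl | hj0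
    · have := hmem i 1 (by omega)
      rw [h0, mul_one, mul_comm]
      exact this
    rcases Nat.lt_or_ge j (d - 1) with hj' | hj'
    · have e : t 1 * (s ^ i * t j) = s ^ i * t (j + 1) + s ^ (i + 1) * t (j - 1) := by
        have := hr j hj0 (by omega)
        linear_combination s ^ i * this
      rw [e]
      exact M.add_mem (hmem _ _ (by omega)) (hmem _ _ (by omega))
    · have : j = d - 1 := le_antisymm hj hj'
      subst this
      rw [hStop, hT]
      have := hmem 0 (d - 1) le_rfl
      rw [pow_zero, one_mul] at this
      exact M.smul_mem _ this
  refine ⟨?_, hSc, ?_⟩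
  · have := hmem 0 0 (by omega)
    simpa [h0] using this
  · intro j
    induction j using Nat.strong_induction_on with
    | _ j ih =>
      intro hj x hx
      match j, ih, hj with
      | 0, _, _ => simpa [h0] using hx
      | 1, _, _ => exact hTc x hx
      | (k + 2), ih, hj =>
        have h := hr (k + 1) (by omega) (by omega)
        have e : t (k + 2) * x = t 1 * (t (k + 1) * x) - s * (t k * x) := by
          simp only [Nat.add_sub_cancel, add_assoc, Nat.reduceAdd] at h
          linear_combination (-x) * h
        rw [e]
        exact M.sub_mem (hTc _ (ih (k + 1) (by omega) (by omega) x hx))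
          (hSc _ (ih k (by omega) (by omega) x hx))

end spanning

section indep

/-- The polynomials expressing `T_j` through `T_1` and `S`. -/
noncomputable def auxP {R : Type*} [CommRing R] (s : R) : ℕ → Polynomial R
  | 0 => 1
  | 1 => Polynomial.X
  | (n + 2) => Polynomial.X * auxP s (n + 1) - Polynomial.C s * auxP s n

theorem auxP_monic {R : Type*} [CommRing R] [Nontrivial R] (s : R) (n : ℕ) :
    (auxP s n).Monic ∧ (auxP s n).natDegree = n := by
  induction n using Nat.strong_induction_on with
  | _ n ih =>
    match n, ih with
    | 0, _ => simp [auxP]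
    | 1, _ => simp [auxP, Polynomial.monic_X]
    | (n + 2), ih =>
      obtain ⟨m1, d1⟩ := ih (n + 1) (by omega)
      obtain ⟨m0, d0⟩ := ih n (by omega)
      have hm : (Polynomial.X * auxP s (n + 1)).Monic := Polynomial.monic_X.mul m1
      have hdg : (Polynomial.X * auxP s (n + 1)).natDegree = n + 2 := by
        rw [Polynomial.monic_X.natDegree_mul m1, d1, Polynomial.natDegree_X]; omega
      have hlt : (Polynomial.C s * auxP s n).degree < (Polynomial.X * auxP s (n + 1)).degree := by
        rw [Polynomial.degree_eq_natDegree hm.ne_zero, hdg]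
        refine lt_of_le_of_lt Polynomial.degree_le_natDegree ?_
        have := Polynomial.natDegree_C_mul_le s (auxP s n)
        exact_mod_cast (by omega : (Polynomial.C s * auxP s n).natDegree < n + 2)
      refine ⟨hm.sub_of_left hlt, ?_⟩
      rw [auxP, Polynomial.natDegree_eq_of_degree_eq (Polynomial.degree_sub_eq_left_of_degree_lt hlt), hdg]

theorem auxP_indep {R : Type*} [CommRing R] [Nontrivial R] (s : R) (n : ℕ) (r : ℕ → R)
    (h : ∑ j ∈ Finset.range n, Polynomial.C (r j) * auxP s j = 0) : ∀ j < n, r j = 0 := by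
  induction n with
  | zero => intro j hj; omega
  | succ n ih =>
    have hn : r n = 0 := by
      have h2 := congrArg (fun p => Polynomial.coeff p n) h
      simp only [Polynomial.finsetSum_coeff, Polynomial.coeff_C_mul, Polynomial.coeff_zero] at h2
      rw [Finset.sum_range_succ, Finset.sum_eq_zero] at h2
      · have h3 := (auxP_monic s n).1.coeff_natDegree
        rw [(auxP_monic s n).2] at h3
        simpa [h3] using h2
      · intro j hj
        rw [Polynomial.coeff_eq_zero_of_natDegree_lt, mul_zero]
        rw [(auxP_monic s j).2]
        exact Finset.mem_range.1 hj
    rw [Finset.sum_range_succ, hn] at h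
    simp only [map_zero, zero_mul, add_zero] at h
    intro j hj
    rcases Nat.lt_succ_iff_lt_or_eq.1 hj with h1 | rfl
    · exact ih h j h1
    · exact hn

theorem auxP_main {R : Type*} [CommRing R] [Nontrivial R] (s : R) (n : ℕ) (r : ℕ → R)
    (b h : Polynomial R)
    (e : ∑ j ∈ Finset.range n, Polynomial.C (r j) * auxP s j + b * auxP s n = auxP s n * h) :
    (∀ j < n, r j = 0) ∧ b = h := by
  have hm := (auxP_monic s n).1
  have hz : ∑ j ∈ Finset.range n, Polynomial.C (r j) * auxP s j = 0 := by
    by_contra hne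
    refine hm.not_dvd_of_degree_lt hne ?_ ⟨h - b, by linear_combination e⟩
    rw [Polynomial.degree_eq_natDegree hm.ne_zero, (auxP_monic s n).2]
    refine lt_of_le_of_lt (Polynomial.degree_sum_le _ _) ?_
    rw [Finset.sup_lt_iff (WithBot.bot_lt_coe _)]
    intro j hj
    refine lt_of_le_of_lt Polynomial.degree_le_natDegree ?_
    have := Polynomial.natDegree_C_mul_le (r j) (auxP s j)
    rw [(auxP_monic s j).2] at this
    have := Finset.mem_range.1 hj
    exact_mod_cast (by omega : (Polynomial.C (r j) * auxP s j).natDegree < n)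
  refine ⟨auxP_indep s n r hz, ?_⟩
  rw [hz, zero_add, mul_comm] at e
  exact hm.isRegular.left e

theorem aux_pow_indep (d : ℕ) (hd : 3 ≤ d) (a : Fin d → ℂ)
    (h : ∑ i, algebraMap ℂ (AdjoinRoot (Polynomial.X ^ d - 1 : Polynomial ℂ)) (a i) *
      (AdjoinRoot.root (Polynomial.X ^ d - 1 : Polynomial ℂ)) ^ (i : ℕ) = 0) : ∀ i, a i = 0 := by
  have hm : (Polynomial.X ^ d - 1 : Polynomial ℂ).Monic := by
    have := Polynomial.monic_X_pow_sub_C (1 : ℂ) (show d ≠ 0 by omega)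
    simpa using this
  have hdeg : (Polynomial.X ^ d - 1 : Polynomial ℂ).natDegree = d := by
    have := Polynomial.natDegree_X_pow_sub_C (n := d) (r := (1 : ℂ))
    simpa using this
  set p : Polynomial ℂ := ∑ i : Fin d, Polynomial.C (a i) * Polynomial.X ^ (i : ℕ) with hp
  have hmk : AdjoinRoot.mk (Polynomial.X ^ d - 1 : Polynomial ℂ) p = 0 := by
    rw [← h, hp, map_sum]
    refine Finset.sum_congr rfl fun i _ => ?_
    rw [map_mul, map_pow, AdjoinRoot.mk_C, AdjoinRoot.mk_X]
    rfl
  have hp0 : p = 0 := by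
    by_contra hne
    refine hm.not_dvd_of_degree_lt hne ?_ (AdjoinRoot.mk_eq_zero.1 hmk)
    rw [Polynomial.degree_eq_natDegree hm.ne_zero, hdeg]
    refine lt_of_le_of_lt (Polynomial.degree_sum_le _ _) ?_
    rw [Finset.sup_lt_iff (WithBot.bot_lt_coe _)]
    intro j hj
    refine lt_of_le_of_lt (Polynomial.degree_C_mul_X_pow_le _ _) ?_
    exact_mod_cast j.2
  intro i
  have h2 := congrArg (fun p => Polynomial.coeff p (i : ℕ)) hp0
  simpa [hp, Polynomial.finsetSum_coeff, Polynomial.coeff_X_pow, Fin.val_inj] using h2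

end indep

theorem Tg_zero (d : ℕ) : Tg d 0 = 1 := by simp [Tg]

/-- evaluation map -/
noncomputable def auxPhi (d : ℕ) {R : Type*} [CommRing R] [Algebra ℂ R] (s : R) :
    MvPolynomial (Fin d) ℂ →ₐ[ℂ] Polynomial R :=
  MvPolynomial.aeval (fun i : Fin d => if (i : ℕ) = 0 then Polynomial.C s else auxP s i)

theorem auxPhi_S (d : ℕ) (hd : 3 ≤ d) {R : Type*} [CommRing R] [Algebra ℂ R] (s : R) :
    auxPhi d s (Sg d) = Polynomial.C s := by
  rw [Sg, dif_pos (by omega), auxPhi, MvPolynomial.aeval_X]; simp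

theorem auxPhi_T (d : ℕ) {R : Type*} [CommRing R] [Algebra ℂ R] (s : R) (j : ℕ)
    (hj : j ≤ d - 1) : auxPhi d s (Tg d j) = auxP s j := by
  rcases Nat.eq_zero_or_pos j with rfl | h
  · simp [Tg_zero, auxP]
  · rw [Tg, dif_pos ⟨h, hj⟩, auxPhi, MvPolynomial.aeval_X]
    simp [show j ≠ 0 by omega]

theorem auxPhi_ideal (d : ℕ) (hd : 3 ≤ d) (v : ℂ) {R : Type*} [CommRing R] [Algebra ℂ R] (s : R)
    (hs : s ^ d = 1) (p : MvPolynomial (Fin d) ℂ) (hp : p ∈ AIdeal d v) :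
    ∃ f g : Polynomial R, auxPhi d s p = auxP s (d - 1) *
      (f * (Polynomial.X - Polynomial.C (algebraMap ℂ R (v + v⁻¹))) +
        g * (Polynomial.C s - 1)) := by
  unfold AIdeal at hp
  induction hp using Submodule.span_induction with
  | mem x h =>
    rcases h with (h | ⟨i, ⟨hi1, hi2⟩, rfl⟩) | h | h
    · rw [Set.mem_singleton_iff] at h
      subst h
      refine ⟨0, 0, ?_⟩
      rw [map_sub, map_pow, auxPhi_S d hd, ← map_pow, hs]
      simp
    · refine ⟨0, 0, ?_⟩
      obtain ⟨k, rfl⟩ : ∃ k, i = k + 1 := ⟨i - 1, by omega⟩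
      simp only [map_sub, map_mul]
      rw [auxPhi_S d hd, auxPhi_T _ _ _ (by omega), auxPhi_T _ _ _ (by omega),
        auxPhi_T _ _ _ (by omega), auxPhi_T _ _ _ (by omega)]
      simp only [auxP, Nat.add_sub_cancel]
      ring
    · subst h
      refine ⟨1, 0, ?_⟩
      simp only [map_sub, map_mul]
      rw [auxPhi_T _ _ _ (by omega), auxPhi_T _ _ _ (by omega)]
      have : auxPhi d s (C (v + v⁻¹)) = Polynomial.C (algebraMap ℂ R (v + v⁻¹)) := by
        rw [auxPhi, MvPolynomial.aeval_C]; rfl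
      rw [this]
      simp only [auxP]
      ring
    · rw [Set.mem_singleton_iff] at h
      subst h
      refine ⟨0, 1, ?_⟩
      simp only [map_sub, map_mul]
      rw [auxPhi_T _ _ _ (by omega), auxPhi_S d hd]
      ring
  | zero => exact ⟨0, 0, by simp⟩
  | add x y hx hy h1 h2 =>
    obtain ⟨f, g, h1⟩ := h1
    obtain ⟨f', g', h2⟩ := h2
    exact ⟨f + f', g + g', by rw [map_add, h1, h2]; ring⟩
  | smul r x hx h1 =>
    obtain ⟨f, g, h1⟩ := h1
    exact ⟨auxPhi d s r * f, auxPhi d s r * g, by rw [smul_eq_mul, map_mul, h1]; ring⟩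

theorem aux_linInd (d : ℕ) (hd : 3 ≤ d) (v : ℂ) :
    LinearIndependent ℂ
        (Sum.elim
          (fun ij : Fin d × Fin (d - 1) =>
            Ideal.Quotient.mk (AIdeal d v) (Sg d ^ (ij.1 : ℕ) * Tg d (ij.2 : ℕ)))
          (fun _ : Unit => Ideal.Quotient.mk (AIdeal d v) (Tg d (d - 1)))) := by
  rw [Fintype.linearIndependent_iff]
  intro a ha
  set q : Polynomial ℂ := Polynomial.X ^ d - 1 with hq
  have hqd : q.degree ≠ 0 := by
    have := Polynomial.degree_X_pow_sub_C (n := d) (by omega) (1 : ℂ)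
    rw [map_one] at this
    rw [hq, this]
    exact_mod_cast (by omega : d ≠ 0)
  have : Nontrivial (AdjoinRoot q) := AdjoinRoot.nontrivial q hqd
  set s := AdjoinRoot.root q with hsdef
  have hs : s ^ d = 1 := by
    have h : AdjoinRoot.mk q q = 0 := AdjoinRoot.mk_self
    conv_lhs at h => arg 2; rw [hq]
    rw [map_sub, map_pow, AdjoinRoot.mk_X, map_one, sub_eq_zero] at h
    exact h
  set F : MvPolynomial (Fin d) ℂ :=
    ∑ ij : Fin d × Fin (d - 1), C (a (Sum.inl ij)) * (Sg d ^ (ij.1 : ℕ) * Tg d (ij.2 : ℕ)) +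
      C (a (Sum.inr ())) * Tg d (d - 1) with hF
  have hFmem : F ∈ AIdeal d v := by
    rw [← Ideal.Quotient.eq_zero_iff_mem, ← ha, Fintype.sum_sum_type, hF, map_add, map_sum]
    have hsm : ∀ (z : ℂ) (x : MvPolynomial (Fin d) ℂ),
        z • Ideal.Quotient.mk (AIdeal d v) x = Ideal.Quotient.mk (AIdeal d v) (C z * x) := by
      intro z x
      rw [MvPolynomial.C_mul']
      rfl
    simp only [Sum.elim_inl, Sum.elim_inr, Finset.univ_unique, Finset.sum_singleton, hsm]
  obtain ⟨f, g, hfg⟩ := auxPhi_ideal d hd v s hs F hFmem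
  have hC : ∀ z : ℂ, auxPhi d s (C z) = Polynomial.C (algebraMap ℂ (AdjoinRoot q) z) := by
    intro z; rw [auxPhi, MvPolynomial.aeval_C]; rfl
  let r : ℕ → AdjoinRoot q := fun j => if h : j < d - 1 then
    ∑ i : Fin d, algebraMap ℂ (AdjoinRoot q) (a (Sum.inl (i, ⟨j, h⟩))) * s ^ (i : ℕ) else 0
  have hphi : auxPhi d s F = ∑ j ∈ Finset.range (d - 1), Polynomial.C (r j) * auxP s j +
      Polynomial.C (algebraMap ℂ (AdjoinRoot q) (a (Sum.inr ()))) * auxP s (d - 1) := by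
    rw [hF, map_add, map_mul, hC, auxPhi_T _ _ _ le_rfl, map_sum, Finset.sum_range,
      Fintype.sum_prod_type_right]
    congr 1
    refine Finset.sum_congr rfl fun j _ => ?_
    simp only [r, j.2, dif_pos, Fin.eta, map_sum, Finset.sum_mul]
    refine Finset.sum_congr rfl fun i _ => ?_
    rw [map_mul, map_mul, map_pow, hC, auxPhi_S d hd, auxPhi_T _ _ _ (by omega), map_mul, map_pow,
      mul_assoc]
  rw [hphi] at hfg
  obtain ⟨h1, h2⟩ := auxP_main s (d - 1) r _ _ hfg
  rintro (⟨i, j⟩ | u)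
  · have := h1 j j.2
    simp only [r, j.2, dif_pos, Fin.eta] at this
    exact aux_pow_indep d hd (fun i => a (Sum.inl (i, j))) this i
  · let ev : AdjoinRoot q →ₐ[ℂ] ℂ := AdjoinRoot.liftAlgHom q (Algebra.ofId ℂ ℂ) 1 (by simp [hq])
    have hev : ev s = 1 := by simp [ev, hsdef]
    have hof : ∀ z : ℂ, ev (algebraMap ℂ (AdjoinRoot q) z) = z := fun z => ev.commutes z
    have h3 := congrArg (Polynomial.eval₂ (ev : AdjoinRoot q →+* ℂ) (v + v⁻¹)) h2
    simp only [Polynomial.eval₂_add, Polynomial.eval₂_mul, Polynomial.eval₂_sub,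
      Polynomial.eval₂_C, Polynomial.eval₂_X, Polynomial.eval₂_one, RingHom.coe_coe, hev, hof,
      sub_self, mul_zero, add_zero] at h3
    exact h3

theorem aux_top (d : ℕ) (hd : 3 ≤ d) (v : ℂ) :
    Submodule.span ℂ
        (Set.range
          (Sum.elim
            (fun ij : Fin d × Fin (d - 1) =>
              Ideal.Quotient.mk (AIdeal d v) (Sg d ^ (ij.1 : ℕ) * Tg d (ij.2 : ℕ)))
            (fun _ : Unit => Ideal.Quotient.mk (AIdeal d v) (Tg d (d - 1))))) = ⊤ := by
  have rel : ∀ x y : MvPolynomial (Fin d) ℂ, x - y ∈ AIdeal d v →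
      Ideal.Quotient.mk (AIdeal d v) x = Ideal.Quotient.mk (AIdeal d v) y :=
    fun x y h => Ideal.Quotient.eq.2 h
  obtain ⟨h1, hS, hT⟩ := aux_span_mem d hd (v + v⁻¹) (Ideal.Quotient.mk (AIdeal d v) (Sg d))
    (fun j => Ideal.Quotient.mk (AIdeal d v) (Tg d j)) (by simp [Tg_zero])
    (by
      rw [← map_pow, ← map_one (Ideal.Quotient.mk (AIdeal d v))]
      exact rel _ _ (Ideal.subset_span (Or.inl (Or.inl rfl))))
    (by
      intro i hi1 hi2
      rw [← map_mul, ← map_mul, ← map_add]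
      refine rel _ _ ?_
      rw [← sub_sub]
      exact Ideal.subset_span (Or.inl (Or.inr ⟨i, ⟨hi1, hi2⟩, rfl⟩)))
    (by
      rw [← map_mul, Algebra.smul_def]
      exact rel _ (C (v + v⁻¹) * Tg d (d - 1)) (Ideal.subset_span (Or.inr (Or.inl rfl))))
    (by
      rw [← map_mul]
      exact rel _ _ (Ideal.subset_span (Or.inr (Or.inr rfl))))
    _ rfl
  simp only [map_mul, map_pow]
  rw [eq_top_iff]
  rintro x -
  obtain ⟨p, rfl⟩ := Ideal.Quotient.mk_surjective x
  induction p using MvPolynomial.induction_on with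
  | C z =>
    have := Submodule.smul_mem _ z h1
    rw [Algebra.smul_def, mul_one] at this
    exact this
  | add p q hp hq =>
    rw [map_add]
    exact Submodule.add_mem _ hp hq
  | mul_X p i hp =>
    rw [map_mul, mul_comm]
    rcases Nat.eq_zero_or_pos (i : ℕ) with h | h
    · have e : X i = Sg d := by
        rw [Sg, dif_pos (by omega)]
        congr 1
        exact Fin.ext h
      rw [e]
      exact hS _ hp
    · have e : X i = Tg d i := by
        rw [Tg, dif_pos ⟨h, by omega⟩]
      rw [e]
      exact hT i (by omega) _ hp

/-- the images in `A = A_W^ℂ` of the monomials `S^i·T_j` for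
`0 ≤ i ≤ d−1`, `0 ≤ j ≤ d−2` together with the image of `T_{d−1}` form a `ℂ`-basis
of `A`; in particular `dim_ℂ A = d(d−1) + 1`. -/
theorem stmt_10 (d : ℕ) (hd : 3 ≤ d) (v : ℂ) (hv : v ≠ 0) :
    LinearIndependent ℂ
        (Sum.elim
          (fun ij : Fin d × Fin (d - 1) =>
            Ideal.Quotient.mk (AIdeal d v) (Sg d ^ (ij.1 : ℕ) * Tg d (ij.2 : ℕ)))
          (fun _ : Unit => Ideal.Quotient.mk (AIdeal d v) (Tg d (d - 1))))
    ∧ Submodule.span ℂ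
        (Set.range
          (Sum.elim
            (fun ij : Fin d × Fin (d - 1) =>
              Ideal.Quotient.mk (AIdeal d v) (Sg d ^ (ij.1 : ℕ) * Tg d (ij.2 : ℕ)))
            (fun _ : Unit => Ideal.Quotient.mk (AIdeal d v) (Tg d (d - 1))))) = ⊤
    ∧ Module.finrank ℂ (MvPolynomial (Fin d) ℂ ⧸ AIdeal d v) = d * (d - 1) + 1 := by
  have hli := aux_linInd d hd v
  have hsp := aux_top d hd v
  refine ⟨hli, hsp, ?_⟩
  rw [Module.finrank_eq_card_basis (Module.Basis.mk hli hsp.ge)]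
  simp
end

section
/- Let J' ⊆ ℂ[X,Y,Z] be the ideal generated by (X−Z)(X−ζZ) and Z^d − Y^d. Then there is an isomorphism of ℂ[X,Y]-modules ℂ[X,Y,Z]/J' ≅ (ℂ[X,Y]/(X^d − Y^d)) ⊕ (ℂ[X,Y]/(X^d − Y^d)). -/
open MvPolynomial

lemma aux_dvd_s11 (d : ℕ) (hd : 2 ≤ d) (ζ : ℂ) (hζ : IsPrimitiveRoot ζ d) :
    ((X 0 - X 1) * (X 0 - C ζ * X 1) : MvPolynomial (Fin 2) ℂ) ∣ X 0 ^ d - X 1 ^ d := by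
  classical
  have hC : IsPrimitiveRoot (C ζ : MvPolynomial (Fin 2) ℂ) d :=
    hζ.map_of_injective (f := (C : ℂ →+* MvPolynomial (Fin 2) ℂ)) (C_injective _ _)
  have hpos : 0 < d := by omega
  rw [hC.pow_sub_pow_eq_prod_sub_mul _ _ hpos]
  have hne : (1 : MvPolynomial (Fin 2) ℂ) ≠ C ζ := (hC.ne_one (by omega)).symm
  have hsub : ({1, C ζ} : Finset (MvPolynomial (Fin 2) ℂ)) ⊆
      Polynomial.nthRootsFinset d (1 : MvPolynomial (Fin 2) ℂ) := by
    intro a ha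
    rw [Polynomial.mem_nthRootsFinset hpos]
    simp only [Finset.mem_insert, Finset.mem_singleton] at ha
    rcases ha with rfl | rfl
    · simp
    · exact hC.pow_eq_one
  have := Finset.prod_dvd_prod_of_subset _ _
    (fun μ : MvPolynomial (Fin 2) ℂ => (X 0 - μ * X 1 : MvPolynomial (Fin 2) ℂ)) hsub
  rw [Finset.prod_pair hne] at this
  simpa using this

lemma aux_pow {A : Type*} [CommRing A] [Algebra ℂ A] (d : ℕ) (hd : 2 ≤ d) (ζ : ℂ)
    (hζ : IsPrimitiveRoot ζ d) (x z : A) :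
    (x - z) * (x - algebraMap ℂ A ζ * z) ∣ x ^ d - z ^ d := by
  have := map_dvd (aeval ![x, z] : MvPolynomial (Fin 2) ℂ →ₐ[ℂ] A) (aux_dvd_s11 d hd ζ hζ)
  simpa [MvPolynomial.algebraMap_eq] using this

lemma aux_inj {B : Type*} [CommRing B] (u v a b : B)
    (h : (Polynomial.X - Polynomial.C u) * (Polynomial.X - Polynomial.C v) ∣
      (Polynomial.C a + Polynomial.C b * Polynomial.X)) : a = 0 ∧ b = 0 := by
  rcases subsingleton_or_nontrivial B with hB | hB
  · exact ⟨Subsingleton.elim _ _, Subsingleton.elim _ _⟩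
  have hm : ((Polynomial.X - Polynomial.C u) * (Polynomial.X - Polynomial.C v)).Monic :=
    (Polynomial.monic_X_sub_C u).mul (Polynomial.monic_X_sub_C v)
  have hz : (Polynomial.C a + Polynomial.C b * Polynomial.X) = 0 := by
    by_contra hne
    refine hm.not_dvd_of_degree_lt hne ?_ h
    rw [(Polynomial.monic_X_sub_C v).degree_mul, Polynomial.degree_X_sub_C,
      Polynomial.degree_X_sub_C]
    rw [add_comm (Polynomial.C a)]
    refine lt_of_le_of_lt Polynomial.degree_linear_le ?_
    rw [one_add_one_eq_two]
    exact_mod_cast (one_lt_two : (1 : ℕ) < 2)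
  constructor
  · simpa using congrArg (fun p => Polynomial.coeff p 0) hz
  · simpa using congrArg (fun p => Polynomial.coeff p 1) hz

theorem aux_main (d : ℕ) (hd : 2 ≤ d) (ζ : ℂ) (hζ : IsPrimitiveRoot ζ d)
    (J : Ideal (MvPolynomial (Fin 3) ℂ))
    (hJ : J = Ideal.span {(X 0 - X 2) * (X 0 - C ζ * X 2),
              (X 2 : MvPolynomial (Fin 3) ℂ) ^ d - X 1 ^ d})
    (I : Ideal (MvPolynomial (Fin 2) ℂ))
    (hI : I = Ideal.span {(X 0 : MvPolynomial (Fin 2) ℂ) ^ d - X 1 ^ d}) :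
    ∃ e : (MvPolynomial (Fin 3) ℂ ⧸ J) ≃+
          ((MvPolynomial (Fin 2) ℂ ⧸ I) × (MvPolynomial (Fin 2) ℂ ⧸ I)),
      ∀ (p : MvPolynomial (Fin 2) ℂ) (x : MvPolynomial (Fin 3) ℂ ⧸ J),
        e (Ideal.Quotient.mk _ (emb p) * x)
          = (Ideal.Quotient.mk _ p * (e x).1, Ideal.Quotient.mk _ p * (e x).2) := by
  have hζ0 : ζ ≠ 0 := hζ.ne_zero (by omega)
  have hq : (X 0 - X 2) * (X 0 - C ζ * X 2) ∈ J := by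
    rw [hJ]; exact Ideal.subset_span (by simp)
  have hzy : (X 2 : MvPolynomial (Fin 3) ℂ) ^ d - X 1 ^ d ∈ J := by
    rw [hJ]; exact Ideal.subset_span (by simp)
  have hxz : (X 0 : MvPolynomial (Fin 3) ℂ) ^ d - X 2 ^ d ∈ J :=
    Ideal.mem_of_dvd _ (aux_pow d hd ζ hζ _ _) hq
  have hxy : (X 0 : MvPolynomial (Fin 3) ℂ) ^ d - X 1 ^ d ∈ J := by
    have := J.add_mem hxz hzy
    simpa using this
  have hIJ : ∀ a ∈ I, ((Ideal.Quotient.mk J).comp (emb : _ →+* _)) a = 0 := by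
    intro a ha
    have : I ≤ RingHom.ker ((Ideal.Quotient.mk J).comp (emb : _ →+* _)) := by
      rw [hI, Ideal.span_le, Set.singleton_subset_iff]
      simp only [SetLike.mem_coe, RingHom.mem_ker, RingHom.comp_apply]
      rw [Ideal.Quotient.eq_zero_iff_mem]
      simpa [emb_X0, emb_X1] using hxy
    exact this ha
  let g : (MvPolynomial (Fin 2) ℂ ⧸ I) →+* (MvPolynomial (Fin 3) ℂ ⧸ J) :=
    Ideal.Quotient.lift I ((Ideal.Quotient.mk J).comp (emb : _ →+* _)) hIJ
  have hg : ∀ p, g (Ideal.Quotient.mk I p) = Ideal.Quotient.mk J (emb p) := fun p => rfl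
  let z : MvPolynomial (Fin 3) ℂ ⧸ J := Ideal.Quotient.mk J (X 2)
  let s : ((MvPolynomial (Fin 2) ℂ ⧸ I) × (MvPolynomial (Fin 2) ℂ ⧸ I)) →+
      (MvPolynomial (Fin 3) ℂ ⧸ J) :=
    { toFun := fun ab => g ab.1 + g ab.2 * z
      map_zero' := by simp
      map_add' := by intro a b; simp only [Prod.fst_add, Prod.snd_add, map_add]; ring }
  have hs : ∀ a b, s (a, b) = g a + g b * z := fun a b => rfl
  -- the relation for `z`
  have hrel : z * z = g (Ideal.Quotient.mk I (-C ζ⁻¹ * X 0 ^ 2)) +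
      g (Ideal.Quotient.mk I (C (1 + ζ⁻¹) * X 0)) * z := by
    rw [hg, hg, ← map_mul, ← map_mul, ← map_add, Ideal.Quotient.eq]
    have h2 := J.mul_mem_left (C ζ⁻¹) hq
    have hcc : (C ζ⁻¹ * C ζ : MvPolynomial (Fin 3) ℂ) = 1 := by
      rw [← C_mul, inv_mul_cancel₀ hζ0, C_1]
    have hC2 : ∀ c : ℂ, emb (C c) = C c := fun c => by simp [emb]
    convert h2 using 1
    simp only [map_mul, map_neg, map_pow, hC2, emb_X0, map_add, map_one]
    linear_combination (X 0 * X 2 - X 2 ^ 2) * hcc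
  have hsurj : Function.Surjective s := by
    intro y
    obtain ⟨p, rfl⟩ := Ideal.Quotient.mk_surjective y
    induction p using MvPolynomial.induction_on with
    | C c => exact ⟨(Ideal.Quotient.mk I (C c), 0), by rw [hs, hg]; simp [emb]⟩
    | add p q hp hq =>
      obtain ⟨a, ha⟩ := hp
      obtain ⟨b, hb⟩ := hq
      exact ⟨a + b, by rw [map_add, ha, hb, map_add]⟩
    | mul_X p i hp =>
      obtain ⟨⟨a, b⟩, ha⟩ := hp
      rw [hs] at ha
      rw [map_mul, ← ha]
      fin_cases i
      · refine ⟨(a * Ideal.Quotient.mk I (X 0), b * Ideal.Quotient.mk I (X 0)), ?_⟩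
        rw [hs, map_mul, map_mul, hg, emb_X0]
        simp only [Fin.zero_eta]
        ring
      · refine ⟨(a * Ideal.Quotient.mk I (X 1), b * Ideal.Quotient.mk I (X 1)), ?_⟩
        rw [hs, map_mul, map_mul, hg, emb_X1]
        simp only [Fin.mk_one]
        ring
      · refine ⟨(b * Ideal.Quotient.mk I (-C ζ⁻¹ * X 0 ^ 2),
          a + b * Ideal.Quotient.mk I (C (1 + ζ⁻¹) * X 0)), ?_⟩
        change _ = (g a + g b * z) * z
        rw [hs, map_mul g, map_add g, map_mul g b]
        linear_combination (-g b) * hrel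
  have hinj : Function.Injective s := by
    let x : MvPolynomial (Fin 2) ℂ ⧸ I := Ideal.Quotient.mk I (X 0)
    let y : MvPolynomial (Fin 2) ℂ ⧸ I := Ideal.Quotient.mk I (X 1)
    let ι : ℂ →+* MvPolynomial (Fin 2) ℂ ⧸ I := (Ideal.Quotient.mk I).comp C
    have hxyI : x ^ d = y ^ d := by
      rw [← map_pow, ← map_pow, Ideal.Quotient.eq, hI]
      exact Ideal.subset_span rfl
    let q : Polynomial (MvPolynomial (Fin 2) ℂ ⧸ I) :=
      (Polynomial.X - Polynomial.C x) * (Polynomial.X - Polynomial.C (ι ζ⁻¹ * x))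
    let o : (MvPolynomial (Fin 2) ℂ ⧸ I) →+* AdjoinRoot q := AdjoinRoot.of q
    let r : AdjoinRoot q := AdjoinRoot.root q
    have hr : (r - o x) * (r - o (ι ζ⁻¹) * o x) = 0 := by
      have : AdjoinRoot.mk q q = 0 := AdjoinRoot.mk_self
      have h2 : AdjoinRoot.mk q q = (r - o x) * (r - o (ι ζ⁻¹) * o x) := by
        change AdjoinRoot.mk q ((Polynomial.X - Polynomial.C x) *
          (Polynomial.X - Polynomial.C (ι ζ⁻¹ * x))) = _
        rw [map_mul, map_sub, map_sub, AdjoinRoot.mk_X, AdjoinRoot.mk_C, AdjoinRoot.mk_C,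
          ← map_mul o]
      rw [← h2, this]
    have hcc : o (ι ζ) * o (ι ζ⁻¹) = 1 := by
      rw [← map_mul, ← map_mul, mul_inv_cancel₀ hζ0, map_one, map_one]
    have hr' : (o x - r) * (o x - o (ι ζ) * r) = 0 := by
      linear_combination o (ι ζ) * hr + (o x * r - o x ^ 2) * hcc
    letI : Algebra ℂ (AdjoinRoot q) := (o.comp ι).toAlgebra
    have hrd : o x ^ d - r ^ d = 0 := by
      have h1 := aux_pow d hd ζ hζ (o x) r
      have h2 : (o x - r) * (o x - algebraMap ℂ (AdjoinRoot q) ζ * r) = 0 := hr'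
      rw [h2] at h1
      exact zero_dvd_iff.mp h1
    let φ0 : MvPolynomial (Fin 3) ℂ →+* AdjoinRoot q := eval₂Hom (o.comp ι) ![o x, o y, r]
    have hφ0 : ∀ a ∈ J, φ0 a = 0 := by
      intro a ha
      have : J ≤ RingHom.ker φ0 := by
        rw [hJ, Ideal.span_le]
        rintro _ (rfl | rfl)
        · simpa [φ0, RingHom.mem_ker] using hr'
        · have : r ^ d - o y ^ d = 0 := by
            rw [← map_pow, ← hxyI, map_pow]
            linear_combination -hrd
          simpa [φ0, RingHom.mem_ker] using this
      exact this ha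
    let φ : (MvPolynomial (Fin 3) ℂ ⧸ J) →+* AdjoinRoot q := Ideal.Quotient.lift J φ0 hφ0
    have hφg : ∀ a, φ (g a) = o a := by
      intro a
      obtain ⟨p, rfl⟩ := Ideal.Quotient.mk_surjective a
      rw [hg]
      change φ0 (emb p) = _
      have : φ0.comp (emb : _ →+* _) = o.comp (Ideal.Quotient.mk I) := by
        apply MvPolynomial.ringHom_ext
        · intro c
          simp [φ0, emb, ι]
        · intro i
          fin_cases i
          · simp [φ0, emb_X0, x]
          · simp [φ0, emb_X1, y]
      exact congrArg (fun h => h p) this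
    have hφz : φ z = r := by
      change φ0 (X 2) = r
      simp [φ0]
    rw [injective_iff_map_eq_zero]
    rintro ⟨a, b⟩ hab
    rw [hs] at hab
    have h1 := congrArg φ hab
    rw [map_add, map_mul, hφg, hφg, hφz, map_zero] at h1
    have h2 : AdjoinRoot.mk q (Polynomial.C a + Polynomial.C b * Polynomial.X) = 0 := by
      rw [map_add, map_mul, AdjoinRoot.mk_X, AdjoinRoot.mk_C, AdjoinRoot.mk_C]
      exact h1
    rw [AdjoinRoot.mk_eq_zero] at h2
    obtain ⟨rfl, rfl⟩ := aux_inj _ _ _ _ h2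
    rfl
  let E := AddEquiv.ofBijective s ⟨hinj, hsurj⟩
  refine ⟨E.symm, fun p w => ?_⟩
  rw [AddEquiv.symm_apply_eq]
  obtain ⟨⟨a, b⟩, rfl⟩ := E.surjective w
  rw [E.symm_apply_apply]
  change _ * s (a, b) = s (_, _)
  rw [hs, hs, map_mul, map_mul, hg]
  ring

/-- with `J' = ((X−Z)(X−ζZ), Z^d − Y^d) ⊆ ℂ[X,Y,Z]`, there is an
isomorphism of `ℂ[X,Y]`-modules
`ℂ[X,Y,Z]/J' ≅ ℂ[X,Y]/(X^d − Y^d) ⊕ ℂ[X,Y]/(X^d − Y^d)`, stated as an additive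
isomorphism commuting with the action of every `p ∈ ℂ[X,Y]`. -/
theorem stmt_11 (d : ℕ) (hd : 2 ≤ d) (ζ : ℂ) (hζ : IsPrimitiveRoot ζ d) :
    ∃ e : (MvPolynomial (Fin 3) ℂ ⧸
            Ideal.span {(X 0 - X 2) * (X 0 - C ζ * X 2),
              (X 2 : MvPolynomial (Fin 3) ℂ) ^ d - X 1 ^ d}) ≃+
          ((MvPolynomial (Fin 2) ℂ ⧸
              Ideal.span {(X 0 : MvPolynomial (Fin 2) ℂ) ^ d - X 1 ^ d}) ×
            (MvPolynomial (Fin 2) ℂ ⧸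
              Ideal.span {(X 0 : MvPolynomial (Fin 2) ℂ) ^ d - X 1 ^ d})),
      ∀ (p : MvPolynomial (Fin 2) ℂ)
        (x : MvPolynomial (Fin 3) ℂ ⧸
          Ideal.span {(X 0 - X 2) * (X 0 - C ζ * X 2),
            (X 2 : MvPolynomial (Fin 3) ℂ) ^ d - X 1 ^ d}),
        e (Ideal.Quotient.mk _ (emb p) * x)
          = (Ideal.Quotient.mk _ p * (e x).1, Ideal.Quotient.mk _ p * (e x).2) :=
  aux_main d hd ζ hζ _ rfl _ rfl
end

section
/- For every nonempty subset A ⊆ {0, 1, …, d−1}, the ℂ[X,Y]-module ℂ[X,Y]/(P_A) is indecomposable; equivalently, ℂ[X,Y]/(P_A) is nonzero and cannot be written as an internal direct sum of two nonzero ℂ[X,Y]-submodules (equivalently, the only idempotent elements of the ring ℂ[X,Y]/(P_A) are 0 and 1). -/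
open MvPolynomial

lemma aux_irred (c : ℂ) : Irreducible (X 0 - C c * X 1 : MvPolynomial (Fin 2) ℂ) := by
  have hc0 : coeff (Finsupp.single 0 1) (X 0 - C c * X 1 : MvPolynomial (Fin 2) ℂ) = 1 := by
    simp [coeff_C_mul, coeff_X, Finsupp.single_eq_single_iff]
  have hhom : (X 0 - C c * X 1 : MvPolynomial (Fin 2) ℂ).IsHomogeneous 1 :=
    (isHomogeneous_X ℂ 0).sub (by simpa using (isHomogeneous_C (Fin 2) c).mul (isHomogeneous_X ℂ 1))
  have hne : (X 0 - C c * X 1 : MvPolynomial (Fin 2) ℂ) ≠ 0 := by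
    intro h
    rw [h] at hc0
    simp at hc0
  apply irreducible_of_totalDegree_eq_one (hhom.totalDegree hne)
  intro x hx
  have := hx (Finsupp.single 0 1)
  rw [hc0] at this
  exact isUnit_of_dvd_one this

lemma aux_dvd_s12 (ζ : ℂ) (A : Finset ℕ) (f g : MvPolynomial (Fin 2) ℂ)
    (hg : eval 0 g ≠ 0)
    (h : (∏ k ∈ A, (X 0 - C (ζ ^ k) * X 1 : MvPolynomial (Fin 2) ℂ)) ∣ f * g) :
    (∏ k ∈ A, (X 0 - C (ζ ^ k) * X 1 : MvPolynomial (Fin 2) ℂ)) ∣ f := by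
  refine IsRelPrime.dvd_of_dvd_mul_right (IsRelPrime.prod_left fun k _ => ?_) h
  rw [(aux_irred _).isRelPrime_iff_not_dvd]
  rintro ⟨q, rfl⟩
  simp at hg

/-- for every nonempty `A ⊆ {0, …, d−1}` and
`P_A = ∏_{k∈A}(X − ζ^k Y)`, the ring `ℂ[X,Y]/(P_A)` is nonzero and its only
idempotents are `0` and `1` (equivalently, it is indecomposable as a
`ℂ[X,Y]`-module). -/
theorem stmt_12 (d : ℕ) (hd : 2 ≤ d) (ζ : ℂ) (hζ : IsPrimitiveRoot ζ d)
    (A : Finset ℕ) (hA : A.Nonempty) (hAd : ∀ k ∈ A, k ≤ d - 1) :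
    ((0 : MvPolynomial (Fin 2) ℂ ⧸
        Ideal.span {∏ k ∈ A, (X 0 - C (ζ ^ k) * X 1 : MvPolynomial (Fin 2) ℂ)}) ≠ 1)
    ∧ ∀ x : MvPolynomial (Fin 2) ℂ ⧸
        Ideal.span {∏ k ∈ A, (X 0 - C (ζ ^ k) * X 1 : MvPolynomial (Fin 2) ℂ)},
        x * x = x → x = 0 ∨ x = 1 := by
  constructor
  · intro h
    have h1 := h.symm
    rw [← map_one (Ideal.Quotient.mk _), Ideal.Quotient.eq_zero_iff_mem,
      Ideal.mem_span_singleton] at h1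
    obtain ⟨k, hk⟩ := hA
    obtain ⟨q, hq⟩ := (Finset.dvd_prod_of_mem _ hk).trans h1
    have := congrArg (eval 0) hq
    simp at this
  · intro x hx
    obtain ⟨f, rfl⟩ := Ideal.Quotient.mk_surjective x
    rw [← map_mul, Ideal.Quotient.mk_eq_mk_iff_sub_mem, Ideal.mem_span_singleton] at hx
    by_cases h0 : eval 0 f = 0
    · left
      rw [Ideal.Quotient.eq_zero_iff_mem, Ideal.mem_span_singleton]
      refine aux_dvd_s12 ζ A f (f - 1) (by rw [map_sub, h0, map_one]; norm_num) ?_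
      convert hx using 1
      ring
    · right
      rw [← map_one (Ideal.Quotient.mk _), Ideal.Quotient.mk_eq_mk_iff_sub_mem,
        Ideal.mem_span_singleton]
      refine aux_dvd_s12 ζ A (f - 1) f h0 ?_
      convert hx using 1
      ring
end

section
/- Let A and B be cyclically connected subsets of ℤ/dℤ and set g_{A,B} = ∏_{k ∈ B∖A}(X − ζ^k Y) ∈ ℂ[X,Y]. Then the space Hom_{ℂ[X,Y]}(ℂ[X,Y]/(P_A), ℂ[X,Y]/(P_B)) of ℂ[X,Y]-module homomorphisms is a free module over ℂ[Y] of rank |A ∩ B|, with basis given by the homomorphisms φ_0, φ_1, …, φ_{|A∩B|−1}, where φ_k sends the class of 1 to the class of X^k · g_{A,B}. -/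
open MvPolynomial

/-- `P_A = ∏_{k∈A}(X − ζ^k Y) ∈ ℂ[X,Y]` for a finite subset `A ⊆ ℤ/dℤ`
(`ζ^k` is computed via the canonical representative `k.val`). -/
noncomputable def PS (d : ℕ) (ζ : ℂ) (A : Finset (ZMod d)) : MvPolynomial (Fin 2) ℂ :=
  ∏ k ∈ A, (X 0 - C (ζ ^ k.val) * X 1)

/-- A subset of `ℤ/dℤ` is cyclically connected if it is of the form
`{a, a+1, …, a+b}` for some `a ∈ ℤ/dℤ` and `0 ≤ b ≤ d−1`. -/
def CyclicallyConnected (d : ℕ) (A : Finset (ZMod d)) : Prop :=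
  ∃ (a : ZMod d) (b : ℕ), b ≤ d - 1 ∧
    A = Finset.image (fun t : ℕ => a + (t : ZMod d)) (Finset.range (b + 1))

/-- Auxiliary map `ℂ[X,Y] → ℂ[Y][X]`. -/
noncomputable def toT : MvPolynomial (Fin 2) ℂ ≃+* Polynomial (Polynomial ℂ) :=
  RingEquiv.ofRingHom
    (eval₂Hom (Polynomial.C.comp Polynomial.C) ![Polynomial.X, Polynomial.C Polynomial.X])
    (Polynomial.eval₂RingHom (Polynomial.aeval (X 1 : MvPolynomial (Fin 2) ℂ)).toRingHom (X 0))
    (by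
      refine Polynomial.ringHom_ext' (Polynomial.ringHom_ext' ?_ ?_) ?_
      · ext a; simp [MvPolynomial.algebraMap_eq]
      · simp
      · simp)
    (by
      apply MvPolynomial.ringHom_ext
      · intro a; simp [MvPolynomial.algebraMap_eq]
      · intro i; fin_cases i <;> simp)

theorem toT_X0 : toT (X 0) = Polynomial.X := by
  simp [toT]

theorem toT_X1 : toT (X 1) = Polynomial.C Polynomial.X := by
  simp [toT]

theorem toT_C (a : ℂ) : toT (C a) = Polynomial.C (Polynomial.C a) := by
  simp [toT]

theorem toT_aeval (q : Polynomial ℂ) :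
    toT (Polynomial.aeval (X 1 : MvPolynomial (Fin 2) ℂ) q) = Polynomial.C q := by
  have h : (toT.toRingHom.comp
      (Polynomial.aeval (X 1 : MvPolynomial (Fin 2) ℂ)).toRingHom) = Polynomial.C := by
    refine Polynomial.ringHom_ext' ?_ ?_
    · ext1 a
      simp [MvPolynomial.algebraMap_eq, toT_C]
    · simp [toT_X1]
  exact congrArg (fun g => g q) h

theorem toT_PS (d : ℕ) (ζ : ℂ) (S : Finset (ZMod d)) :
    toT (PS d ζ S) = ∏ k ∈ S,
      (Polynomial.X - Polynomial.C (Polynomial.C (ζ ^ k.val) * Polynomial.X)) := by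
  simp only [PS, map_prod, map_sub, map_mul, toT_X0, toT_X1, toT_C]

theorem toT_PS_monic (d : ℕ) (ζ : ℂ) (S : Finset (ZMod d)) : (toT (PS d ζ S)).Monic := by
  rw [toT_PS]
  exact Polynomial.monic_prod_of_monic _ _ fun k _ => Polynomial.monic_X_sub_C _

theorem toT_PS_natDegree (d : ℕ) (ζ : ℂ) (S : Finset (ZMod d)) :
    (toT (PS d ζ S)).natDegree = S.card := by
  rw [toT_PS, Polynomial.natDegree_prod_of_monic _ _ fun k _ => Polynomial.monic_X_sub_C _]
  simp only [Polynomial.natDegree_X_sub_C, Finset.sum_const, smul_eq_mul, mul_one]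

theorem existsUnique_rem {R : Type*} [CommRing R] [Nontrivial R] (P : Polynomial R)
    (hP : P.Monic) (n : ℕ) (hn : P.natDegree = n) (u : Polynomial R) :
    ∃! q : Fin n → R, P ∣ u - ∑ k : Fin n, Polynomial.C (q k) * Polynomial.X ^ (k : ℕ) := by
  have hdeg : P.degree = n := by rw [Polynomial.degree_eq_natDegree hP.ne_zero, hn]
  refine ⟨fun k => (u %ₘ P).coeff k, ?_, ?_⟩
  · have h := Polynomial.sum_modByMonic_coeff (p := u) hP hdeg.le
    simp only [← Polynomial.C_mul_X_pow_eq_monomial] at h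
    simp only [h]
    refine ⟨u /ₘ P, ?_⟩
    linear_combination -(Polynomial.modByMonic_add_div u P)
  · rintro q ⟨w, hw⟩
    have hlt := Polynomial.degree_sum_fin_lt q
    rw [← hdeg] at hlt
    have h2 := (Polynomial.div_modByMonic_unique (f := u) w _ hP
      ⟨by linear_combination (-hw), hlt⟩).2
    funext k
    rw [h2]
    simp [Polynomial.coeff_C_mul, Polynomial.coeff_X_pow,
      Fin.val_inj]

theorem PS_relPrime (d : ℕ) (hd : 2 ≤ d) (ζ : ℂ) (hζ : IsPrimitiveRoot ζ d)
    (S T : Finset (ZMod d)) (h : Disjoint S T) :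
    IsRelPrime (toT (PS d ζ S)) (toT (PS d ζ T)) := by
  have : NeZero d := ⟨by omega⟩
  rw [toT_PS, toT_PS]
  refine IsRelPrime.prod_left fun i hi => IsRelPrime.prod_right fun j hj => ?_
  rw [(Polynomial.prime_X_sub_C _).irreducible.isRelPrime_iff_not_dvd]
  intro hdvd
  rw [Polynomial.dvd_iff_isRoot] at hdvd
  simp only [Polynomial.IsRoot.def, Polynomial.eval_sub, Polynomial.eval_X,
    Polynomial.eval_C, sub_eq_zero] at hdvd
  have h1 := congrArg (fun p => Polynomial.coeff p 1) hdvd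
  simp only [Polynomial.coeff_C_mul, Polynomial.coeff_X_one, mul_one] at h1
  have h2 := hζ.pow_inj (ZMod.val_lt i) (ZMod.val_lt j) h1
  have h3 := ZMod.val_injective d h2
  subst h3
  exact Finset.disjoint_left.mp h hi hj

theorem PS_split (d : ℕ) (ζ : ℂ) (A B : Finset (ZMod d)) :
    PS d ζ B = PS d ζ (B \ A) * PS d ζ (A ∩ B) := by
  unfold PS
  rw [← Finset.prod_union (by
    rw [Finset.disjoint_left]; intro x; simp; tauto)]
  congr 1
  ext x; simp; tauto

/-- for cyclically connected `A, B ⊆ ℤ/dℤ` and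
`g_{A,B} = ∏_{k∈B∖A}(X − ζ^k Y)`, the space `Hom_{ℂ[X,Y]}(ℂ[X,Y]/(P_A), ℂ[X,Y]/(P_B))`
is a free `ℂ[Y]`-module of rank `|A ∩ B|` with basis `φ_0, …, φ_{|A∩B|−1}`, where
`φ_k([1]) = [X^k·g_{A,B}]`: each `φ_k` is a well-defined `ℂ[X,Y]`-module map, and every
`f` is uniquely a `ℂ[Y]`-linear combination `f = Σ_k q_k(Y)·φ_k`. -/
theorem stmt_14 (d : ℕ) (hd : 2 ≤ d) (ζ : ℂ) (hζ : IsPrimitiveRoot ζ d)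
    (A B : Finset (ZMod d))
    (hA : CyclicallyConnected d A) (hB : CyclicallyConnected d B) :
    (∀ k : Fin (A ∩ B).card,
      ∃ φ : (MvPolynomial (Fin 2) ℂ ⧸ Ideal.span {PS d ζ A}) →ₗ[MvPolynomial (Fin 2) ℂ]
          (MvPolynomial (Fin 2) ℂ ⧸ Ideal.span {PS d ζ B}),
        ∀ p : MvPolynomial (Fin 2) ℂ,
          φ (Ideal.Quotient.mk (Ideal.span {PS d ζ A}) p)
            = Ideal.Quotient.mk (Ideal.span {PS d ζ B})
                (p * (X 0 ^ (k : ℕ) * PS d ζ (B \ A))))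
    ∧ ∀ f : (MvPolynomial (Fin 2) ℂ ⧸ Ideal.span {PS d ζ A}) →ₗ[MvPolynomial (Fin 2) ℂ]
          (MvPolynomial (Fin 2) ℂ ⧸ Ideal.span {PS d ζ B}),
        ∃! q : Fin (A ∩ B).card → Polynomial ℂ,
          ∀ p : MvPolynomial (Fin 2) ℂ,
            f (Ideal.Quotient.mk (Ideal.span {PS d ζ A}) p)
              = Ideal.Quotient.mk (Ideal.span {PS d ζ B})
                  (p * ∑ k : Fin (A ∩ B).card,
                    Polynomial.aeval (X 1 : MvPolynomial (Fin 2) ℂ) (q k) *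
                      (X 0 ^ (k : ℕ) * PS d ζ (B \ A))) := by
  have hs : ∀ (Q p x : MvPolynomial (Fin 2) ℂ),
      p • (Ideal.Quotient.mk (Ideal.span {Q}) x) = Ideal.Quotient.mk (Ideal.span {Q}) (p * x) :=
    fun _ _ _ => rfl
  have hAeq : PS d ζ A = PS d ζ (A \ B) * PS d ζ (A ∩ B) := by
    rw [Finset.inter_comm]; exact PS_split d ζ B A
  have hBeq := PS_split d ζ A B
  constructor
  · intro k
    refine ⟨Submodule.liftQ _ (LinearMap.toSpanSingleton _ _
      (Ideal.Quotient.mk (Ideal.span {PS d ζ B}) (X 0 ^ (k : ℕ) * PS d ζ (B \ A)))) ?_, ?_⟩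
    · rw [Ideal.span, Submodule.span_le, Set.singleton_subset_iff]
      change PS d ζ A • (Ideal.Quotient.mk (Ideal.span {PS d ζ B})
        (X 0 ^ (k : ℕ) * PS d ζ (B \ A))) = 0
      rw [hs,
        Ideal.Quotient.eq_zero_iff_mem, Ideal.mem_span_singleton, hAeq, hBeq]
      exact ⟨PS d ζ (A \ B) * X 0 ^ (k : ℕ), by ring⟩
    · intro p
      change p • (Ideal.Quotient.mk (Ideal.span {PS d ζ B})
        (X 0 ^ (k : ℕ) * PS d ζ (B \ A))) = _
      rw [hs]
  · intro f
    obtain ⟨h, hh⟩ := Ideal.Quotient.mk_surjective (f (Ideal.Quotient.mk _ 1))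
    have hf : ∀ p, f (Ideal.Quotient.mk _ p) =
        Ideal.Quotient.mk (Ideal.span {PS d ζ B}) (p * h) := by
      intro p
      have h1 : (Ideal.Quotient.mk (Ideal.span {PS d ζ A}) p) =
          p • Ideal.Quotient.mk (Ideal.span {PS d ζ A}) 1 := by
        rw [hs, mul_one]
      rw [h1, map_smul, ← hh, hs]
    have hz : PS d ζ B ∣ PS d ζ A * h := by
      rw [← Ideal.mem_span_singleton, ← Ideal.Quotient.eq_zero_iff_mem, ← hf,
        Ideal.Quotient.eq_zero_iff_mem.mpr (Ideal.mem_span_singleton_self _), map_zero]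
    have hne : ∀ S, PS d ζ S ≠ 0 := by
      intro S hS
      have := (toT_PS_monic d ζ S).ne_zero
      rw [hS, map_zero] at this
      exact this rfl
    have hg : PS d ζ (B \ A) ∣ h := by
      rw [hAeq, hBeq, mul_right_comm (PS d ζ (A \ B))] at hz
      have h1 := map_dvd toT ((mul_dvd_mul_iff_right (hne _)).mp hz)
      rw [map_mul] at h1
      have h2 := (PS_relPrime d hd ζ hζ (B \ A) (A \ B)
        (by rw [Finset.disjoint_left]; intro x; simp; tauto)).dvd_of_dvd_mul_left h1
      exact (map_dvd_iff toT).mp h2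
    obtain ⟨u, rfl⟩ := hg
    have key : ∀ q : Fin (A ∩ B).card → Polynomial ℂ,
        (∀ p : MvPolynomial (Fin 2) ℂ,
            f (Ideal.Quotient.mk (Ideal.span {PS d ζ A}) p)
              = Ideal.Quotient.mk (Ideal.span {PS d ζ B})
                  (p * ∑ k : Fin (A ∩ B).card,
                    Polynomial.aeval (X 1 : MvPolynomial (Fin 2) ℂ) (q k) *
                      (X 0 ^ (k : ℕ) * PS d ζ (B \ A)))) ↔
        toT (PS d ζ (A ∩ B)) ∣ toT u - ∑ k : Fin (A ∩ B).card,
          Polynomial.C (q k) * Polynomial.X ^ (k : ℕ) := by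
      intro q
      have e1 : toT u - ∑ k : Fin (A ∩ B).card,
          Polynomial.C (q k) * Polynomial.X ^ (k : ℕ) =
          toT (u - ∑ k : Fin (A ∩ B).card,
            Polynomial.aeval (X 1 : MvPolynomial (Fin 2) ℂ) (q k) * X 0 ^ (k : ℕ)) := by
        simp only [map_sub, map_sum, map_mul, map_pow, toT_aeval, toT_X0]
      have e2 : ∑ k : Fin (A ∩ B).card,
            Polynomial.aeval (X 1 : MvPolynomial (Fin 2) ℂ) (q k) *
              (X 0 ^ (k : ℕ) * PS d ζ (B \ A)) =
          PS d ζ (B \ A) * ∑ k : Fin (A ∩ B).card,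
            Polynomial.aeval (X 1 : MvPolynomial (Fin 2) ℂ) (q k) * X 0 ^ (k : ℕ) := by
        rw [Finset.mul_sum]
        exact Finset.sum_congr rfl fun k _ => by ring
      rw [e1, map_dvd_iff, e2]
      rw [← mul_dvd_mul_iff_left (hne (B \ A)), ← hBeq, mul_sub]
      constructor
      · intro H
        have := H 1
        rwa [hf, Ideal.Quotient.eq, one_mul, one_mul, Ideal.mem_span_singleton] at this
      · intro H p
        rw [hf, Ideal.Quotient.eq, Ideal.mem_span_singleton, ← mul_sub]
        exact H.mul_left p
    simp only [key]
    exact existsUnique_rem _ (toT_PS_monic d ζ _) _ (toT_PS_natDegree d ζ _) _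
end

section
/- (Semisimplicity) Suppose that v + v^{−1} ≠ 2·cos(kπ/d) for every k = 1, …, d−1. Then the ℂ-algebra A = A_W^ℂ is a semisimple ring. -/
open MvPolynomial

/-- Two-variable Chebyshev-like sequence. -/
def pp {R : Type*} [CommRing R] (s t : R) : ℕ → R
  | 0 => 1
  | 1 => t
  | (n + 2) => t * pp s t (n + 1) - s * pp s t n

/-- Its formal derivative in `t`. -/
def qq {R : Type*} [CommRing R] (s t : R) : ℕ → R
  | 0 => 0
  | 1 => 1
  | (n + 2) => pp s t (n + 1) + t * qq s t (n + 1) - s * qq s t n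

theorem qq_identity {R : Type*} [CommRing R] (s t : R) (n : ℕ) :
    (t ^ 2 - 4 * s) * qq s t (n + 1)
      = (n + 1) * t * pp s t (n + 1) - 2 * (n + 2) * s * pp s t n := by
  induction n using Nat.twoStepInduction with
  | zero => simp [pp, qq]; ring
  | one => simp [pp, qq]; ring
  | more n h1 h2 =>
    have e : qq s t (n + 2 + 1) = pp s t (n + 2) + t * qq s t (n + 2) - s * qq s t (n + 1) := rfl
    have e1 : pp s t (n + 2 + 1) = t * pp s t (n + 2) - s * pp s t (n + 1) := rfl
    have e2 : pp s t (n + 2) = t * pp s t (n + 1) - s * pp s t n := rfl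
    have h2' : (t ^ 2 - 4 * s) * qq s t (n + 2)
      = ((n : R) + 1 + 1) * t * pp s t (n + 2) - 2 * ((n : R) + 1 + 2) * s * pp s t (n + 1) := by
      have := h2
      push_cast at this
      exact this
    rw [e, e1]
    push_cast
    linear_combination t * h2' - s * h1 + (2 * (n + 2) * s) * e2

theorem pp_consecutive {K : Type*} [Field K] (s t : K) (hs : s ≠ 0) (n : ℕ)
    (h0 : pp s t n = 0) : pp s t (n + 1) ≠ 0 := by
  induction n with
  | zero => simp [pp] at h0
  | succ n ih =>
    intro h1
    have e2 : pp s t (n + 1 + 1) = t * pp s t (n + 1) - s * pp s t n := rfl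
    rw [h1, h0] at e2
    have : pp s t n = 0 := by
      have : s * pp s t n = 0 := by linear_combination e2
      exact (mul_eq_zero.mp this).resolve_left hs
    exact ih this h0

theorem qq_ne_zero {K : Type*} [Field K] [CharZero K] (s t : K) (hs : s ≠ 0) (n : ℕ)
    (h0 : pp s t n = 0) : qq s t n ≠ 0 := by
  cases n with
  | zero => simp [pp] at h0
  | succ n =>
    intro h1
    have := qq_identity s t n
    rw [h0, h1] at this
    have h2 : (2 * ((n : K) + 2) * s) * pp s t n = 0 := by linear_combination this
    have hn : (2 * ((n : K) + 2) * s) ≠ 0 := by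
      have : ((n : K) + 2) ≠ 0 := by exact_mod_cast (by omega : n + 2 ≠ 0)
      simp [this, hs]
    exact pp_consecutive s t hs n ((mul_eq_zero.mp h2).resolve_left hn) h0

theorem pp_map {R R' : Type*} [CommRing R] [CommRing R'] (f : R →+* R') (s t : R) (n : ℕ) :
    f (pp s t n) = pp (f s) (f t) n := by
  induction n using Nat.twoStepInduction with
  | zero => simp [pp]
  | one => simp [pp]
  | more n h1 h2 => simp [pp, h1, h2]

theorem qq_map {R R' : Type*} [CommRing R] [CommRing R'] (f : R →+* R') (s t : R) (n : ℕ) :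
    f (qq s t n) = qq (f s) (f t) n := by
  induction n using Nat.twoStepInduction with
  | zero => simp [qq]
  | one => simp [qq]
  | more n h1 h2 => simp [qq, h1, h2, pp_map]

theorem pp_closed (v w : ℂ) (h : v * w = 1) (n : ℕ) :
    (v - w) * pp 1 (v + w) n = v ^ (n + 1) - w ^ (n + 1) := by
  induction n using Nat.twoStepInduction with
  | zero => simp [pp]
  | one => simp [pp]; ring
  | more n h1 h2 =>
    simp only [pp]
    have h3 : v ^ (n + 1) * (v * w) = v ^ (n + 1) := by rw [h, mul_one]
    have h4 : w ^ (n + 1) * (v * w) = w ^ (n + 1) := by rw [h, mul_one]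
    linear_combination (v + w) * h2 - h1 + h3 - h4

theorem pp_double (v : ℂ) (h : v * v = 1) (n : ℕ) :
    pp 1 (v + v) n = (n + 1) * v ^ n := by
  induction n using Nat.twoStepInduction with
  | zero => simp [pp]
  | one => simp [pp]; ring
  | more n h1 h2 =>
    simp only [pp, h1, h2]
    push_cast
    linear_combination (((n : ℂ) + 1) * v ^ n) * h

theorem pp_cos (d : ℕ) (hd : 3 ≤ d) (v : ℂ) (hv : v ≠ 0)
    (h : ∀ k : ℕ, 1 ≤ k → k ≤ d - 1 →
      v + v⁻¹ ≠ 2 * Complex.cos ((k : ℂ) * Real.pi / d)) :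
    pp 1 (v + v⁻¹) (d - 1) ≠ 0 := by
  intro h0
  have hd0 : (d : ℂ) ≠ 0 := by exact_mod_cast (by omega : d ≠ 0)
  have hvv : v * v⁻¹ = 1 := mul_inv_cancel₀ hv
  have hne : v ≠ v⁻¹ := by
    intro he
    rw [← he] at hvv h0
    rw [pp_double v hvv] at h0
    have : (((d - 1 : ℕ) : ℂ) + 1) ≠ 0 := by exact_mod_cast (by omega : d - 1 + 1 ≠ 0)
    simp [this, hv] at h0
  have h1 := pp_closed v v⁻¹ hvv (d - 1)
  rw [h0, mul_zero, (by omega : d - 1 + 1 = d)] at h1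
  have h2 : v ^ (2 * d) = 1 := by
    have h3 : v ^ d = (v⁻¹) ^ d := by linear_combination -h1
    rw [two_mul, pow_add]
    nth_rewrite 2 [h3]
    rw [← mul_pow, hvv, one_pow]
  haveI : NeZero (2 * d) := ⟨by omega⟩
  obtain ⟨k, hk, hkv⟩ :=
    (Complex.isPrimitiveRoot_exp (2 * d) (by omega)).eq_pow_of_pow_eq_one h2
  rw [← Complex.exp_nat_mul] at hkv
  have hkv' : v = Complex.exp (((k : ℂ) * Real.pi / d) * Complex.I) := by
    rw [← hkv]; congr 1; push_cast; field_simp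
  have hc : v + v⁻¹ = 2 * Complex.cos ((k : ℂ) * Real.pi / d) := by
    rw [Complex.two_cos, hkv', ← Complex.exp_neg]; congr 2; ring
  rcases Nat.lt_trichotomy k d with hlt | heq | hgt
  · rcases Nat.eq_zero_or_pos k with rfl | hpos
    · simp at hkv'
      simp [hkv'] at hne
    · exact h k hpos (by omega) hc
  · subst heq
    have : (k : ℂ) * Real.pi / k = Real.pi := by field_simp
    rw [this, Complex.exp_pi_mul_I] at hkv'
    apply hne
    rw [hkv']; norm_num
  · apply h (2 * d - k) (by omega) (by omega)
    rw [hc, Nat.cast_sub (by omega)]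
    have : (((2 * d : ℕ) : ℂ) - k) * Real.pi / d = 2 * Real.pi - (k : ℂ) * Real.pi / d := by
      push_cast; field_simp
    rw [this, Complex.cos_two_pi_sub]

/-- Abstract core: derivation on an algebra satisfying the relations vanishes on `S`, `T`. -/
theorem deriv_core {A M : Type*} [CommRing A] [Algebra ℂ A] [AddCommGroup M] [Module ℂ M]
    [Module A M] (D : Derivation ℂ A M) (d : ℕ) (hd : 3 ≤ d) (c : ℂ)
    (hc : pp 1 c (d - 1) ≠ 0) (s t : A) (hs : s ^ d = 1)
    (h1 : t * pp s t (d - 1) = algebraMap ℂ A c * pp s t (d - 1))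
    (h2 : s * pp s t (d - 1) = pp s t (d - 1)) :
    D s = 0 ∧ ∀ n, D (pp s t n) = 0 := by
  have hDs : D s = 0 := by
    have h := congrArg D hs
    rw [D.leibniz_pow, D.map_one_eq_zero] at h
    have h' : (algebraMap ℂ A (d : ℂ)⁻¹ * s) • (d • s ^ (d - 1) • D s) = 0 := by rw [h, smul_zero]
    rw [← Nat.cast_smul_eq_nsmul A, smul_smul, smul_smul] at h'
    have e : algebraMap ℂ A (d : ℂ)⁻¹ * s * ((d : A) * s ^ (d - 1)) = 1 := by
      have e1 : algebraMap ℂ A (d : ℂ)⁻¹ * (d : A) = 1 := by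
        rw [← map_natCast (algebraMap ℂ A), ← map_mul, inv_mul_cancel₀, map_one]
        exact_mod_cast (by omega : d ≠ 0)
      have e2 : s * s ^ (d - 1) = 1 := by
        rw [← pow_succ', (by omega : d - 1 + 1 = d), hs]
      calc _ = (algebraMap ℂ A (d : ℂ)⁻¹ * (d : A)) * (s * s ^ (d - 1)) := by ring
        _ = 1 := by rw [e1, e2, one_mul]
    rw [← mul_assoc] at e
    rwa [e, one_smul] at h'
  have hD : ∀ n, D (pp s t n) = qq s t n • D t := by
    intro n
    induction n using Nat.twoStepInduction with
    | zero => simp [pp, qq]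
    | one => simp [pp, qq]
    | more n h1 h2 =>
      simp only [pp, qq, map_sub, D.leibniz, h1, h2, hDs, smul_zero, add_zero, smul_smul,
        sub_smul, add_smul]
      abel
  refine ⟨hDs, ?_⟩
  suffices hDt : D t = 0 by
    intro n; rw [hD, hDt, smul_zero]
  have r1 : (pp s t (d - 1) + (t - algebraMap ℂ A c) * qq s t (d - 1)) • D t = 0 := by
    have h := congrArg D h1
    simp only [D.leibniz, D.map_algebraMap, hD, smul_smul, smul_zero, add_zero] at h
    rw [add_smul, sub_mul, sub_smul, ← h]
    abel
  have r2 : ((s - 1) * qq s t (d - 1)) • D t = 0 := by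
    have h := congrArg D h2
    simp only [D.leibniz, hDs, hD, smul_smul, smul_zero, add_zero] at h
    rw [sub_mul, sub_smul, one_mul, h, sub_self]
  by_contra hne
  have hI : LinearMap.ker (LinearMap.toSpanSingleton A M (D t)) ≠ ⊤ := by
    intro htop
    have : (1 : A) ∈ LinearMap.ker (LinearMap.toSpanSingleton A M (D t)) := by
      rw [htop]; trivial
    simp at this
    exact hne this
  obtain ⟨m, hm, hle⟩ := Ideal.exists_le_maximal _ hI
  letI : Field (A ⧸ m) := Ideal.Quotient.field m
  haveI : CharZero (A ⧸ m) := charZero_of_injective_algebraMap (algebraMap ℂ (A ⧸ m)).injective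
  let f := Ideal.Quotient.mk m
  have z1 : f (pp s t (d - 1) + (t - algebraMap ℂ A c) * qq s t (d - 1)) = 0 :=
    Ideal.Quotient.eq_zero_iff_mem.mpr (hle (by simpa using r1))
  have z2 : f ((s - 1) * qq s t (d - 1)) = 0 :=
    Ideal.Quotient.eq_zero_iff_mem.mpr (hle (by simpa using r2))
  have z3 := congrArg f h1
  have z4 := congrArg f h2
  have z5 := congrArg f hs
  have hfc : f (algebraMap ℂ A c) = algebraMap ℂ (A ⧸ m) c := rfl
  simp only [map_add, map_mul, map_sub, map_one, map_pow, pp_map, qq_map, hfc] at z1 z2 z3 z4 z5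
  have hs0 : f s ≠ 0 := by
    intro h
    rw [h, zero_pow (by omega)] at z5
    exact zero_ne_one z5
  have hp : pp (f s) (f t) (d - 1) = 0 := by
    by_contra hp
    have e : f t = algebraMap ℂ (A ⧸ m) c := mul_right_cancel₀ hp z3
    rw [e, sub_self, zero_mul, add_zero] at z1
    rw [e] at hp
    exact hp z1
  have hq := qq_ne_zero (f s) (f t) hs0 _ hp
  have e1 : f s = 1 := sub_eq_zero.mp ((mul_eq_zero.mp z2).resolve_right hq)
  rw [hp, zero_add] at z1
  have e2 : f t = algebraMap ℂ (A ⧸ m) c := sub_eq_zero.mp ((mul_eq_zero.mp z1).resolve_right hq)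
  rw [e1, e2, ← map_one (algebraMap ℂ (A ⧸ m)), ← pp_map] at hp
  exact hc ((map_eq_zero _).mp hp)

/-- Semisimplicity: if `v + v⁻¹ ≠ 2·cos(kπ/d)` for every
`k = 1, …, d−1`, then the `ℂ`-algebra `A_W^ℂ` is a semisimple ring. -/
theorem stmt_19 (d : ℕ) (hd : 3 ≤ d) (v : ℂ) (hv : v ≠ 0)
    (h : ∀ k : ℕ, 1 ≤ k → k ≤ d - 1 →
      v + v⁻¹ ≠ 2 * Complex.cos ((k : ℂ) * Real.pi / d)) :
    IsSemisimpleRing (MvPolynomial (Fin d) ℂ ⧸ AIdeal d v) := by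
  have hc := pp_cos d hd v hv h
  let π := Ideal.Quotient.mk (AIdeal d v)
  have rel : ∀ x ∈ AIdeal d v, π x = 0 := fun x hx => Ideal.Quotient.eq_zero_iff_mem.mpr hx
  have hS : π (Sg d) ^ d = 1 := by
    have := rel (Sg d ^ d - 1) (Ideal.subset_span (by simp))
    rw [map_sub, map_pow, map_one] at this
    exact sub_eq_zero.mp this
  have hrec : ∀ i, 1 ≤ i → i ≤ d - 2 →
      π (Tg d (i + 1)) = π (Tg d 1) * π (Tg d i) - π (Sg d) * π (Tg d (i - 1)) := by
    intro i hi hi'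
    have := rel (Tg d 1 * Tg d i - Tg d (i + 1) - Sg d * Tg d (i - 1))
      (Ideal.subset_span (Or.inl (Or.inr ⟨i, ⟨hi, hi'⟩, rfl⟩)))
    simp only [map_sub, map_mul] at this
    linear_combination -this
  have hT : ∀ n, n ≤ d - 1 → π (Tg d n) = pp (π (Sg d)) (π (Tg d 1)) n := by
    intro n
    induction n using Nat.twoStepInduction with
    | zero => intro _; simp [pp, Tg]
    | one => intro _; simp [pp]
    | more n h1 h2 =>
      intro hn
      rw [hrec (n + 1) (by omega) (by omega), h2 (by omega)]
      simp only [Nat.add_sub_cancel]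
      rw [h1 (by omega)]
      rfl
  have hlast := hT (d - 1) le_rfl
  have hA : π (Tg d 1) * π (Tg d (d - 1)) = algebraMap ℂ _ (v + v⁻¹) * π (Tg d (d - 1)) := by
    have := rel (Tg d 1 * Tg d (d - 1) - C (v + v⁻¹) * Tg d (d - 1))
      (Ideal.subset_span (by simp))
    rw [map_sub, map_mul, map_mul] at this
    exact sub_eq_zero.mp this
  have hB : π (Sg d) * π (Tg d (d - 1)) = π (Tg d (d - 1)) := by
    have := rel (Sg d * Tg d (d - 1) - Tg d (d - 1)) (Ideal.subset_span (by simp))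
    rw [map_sub, map_mul] at this
    exact sub_eq_zero.mp this
  rw [hlast] at hA hB
  obtain ⟨k1, k2⟩ := deriv_core
    (KaehlerDifferential.D ℂ (MvPolynomial (Fin d) ℂ ⧸ AIdeal d v)) d hd (v + v⁻¹) hc
    (π (Sg d)) (π (Tg d 1)) hS hA hB
  have hall : ∀ x, KaehlerDifferential.D ℂ (MvPolynomial (Fin d) ℂ ⧸ AIdeal d v) x = 0 := by
    intro x
    obtain ⟨p, rfl⟩ := Ideal.Quotient.mk_surjective x
    induction p using MvPolynomial.induction_on with
    | C a => exact Derivation.map_algebraMap _ a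
    | add p q hp hq => rw [map_add, map_add, hp, hq, add_zero]
    | mul_X p i hp =>
      rw [map_mul, Derivation.leibniz, hp, smul_zero, add_zero]
      have : KaehlerDifferential.D ℂ (MvPolynomial (Fin d) ℂ ⧸ AIdeal d v) (π (X i)) = 0 := by
        by_cases hi : (i : ℕ) = 0
        · have e : (X i : MvPolynomial (Fin d) ℂ) = Sg d := by
            rw [Sg, dif_pos (by omega)]
            congr 1
            exact Fin.ext hi
          rw [e]; exact k1
        · have hi2 := i.isLt
          have e : (X i : MvPolynomial (Fin d) ℂ) = Tg d i := by
            rw [Tg, dif_pos ⟨by omega, by omega⟩]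
          rw [e, hT i (by omega)]; exact k2 i
      rw [this, smul_zero]
  have hfu : Algebra.FormallyUnramified ℂ (MvPolynomial (Fin d) ℂ ⧸ AIdeal d v) := by
    constructor
    suffices (⊤ : Submodule (MvPolynomial (Fin d) ℂ ⧸ AIdeal d v)
        (KaehlerDifferential ℂ (MvPolynomial (Fin d) ℂ ⧸ AIdeal d v))) ≤ ⊥ from
      (subsingleton_iff_forall_eq 0).mpr fun y => this trivial
    rw [← KaehlerDifferential.span_range_derivation, Submodule.span_le]
    rintro _ ⟨x, rfl⟩
    exact hall x
  have hred : IsReduced (MvPolynomial (Fin d) ℂ ⧸ AIdeal d v) :=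
    Algebra.FormallyUnramified.isReduced_of_field ℂ _
  have hfin : Module.Finite ℂ (MvPolynomial (Fin d) ℂ ⧸ AIdeal d v) :=
    Algebra.FormallyUnramified.finite_of_free ℂ _
  have hart : IsArtinianRing (MvPolynomial (Fin d) ℂ ⧸ AIdeal d v) :=
    IsArtinianRing.of_finite ℂ _
  exact IsArtinianRing.isSemisimpleRing_of_isReduced _
end
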